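/- arXiv:2309.10760 — 4 statements merged into one kernel-verified Lean document; each statement's English description precedes it below -/
import Mathlib

section
/- Let X be a complete connected median space of rank n and let C be a nonempty closed bounded subset of X. Then the following are equivalent: (1) C is compact; (2) for every x₀ ∈ C and every ε > 0 there exist finitely many points x₁, …, x_k ∈ C such that every x ∈ C satisfies d(x, [x₀, xᵢ]) ≤ ε for some i ∈ {1,…,k}; (3) for every ε > 0, every family of pairwise disjoint halfspaces of X, each transverse to C and of depth greater than ε in Conv(C), is finite. -/
/-- The interval `[a,b]` in a metric space: points `x` with `d(a,x) + d(x,b) = d(a,b)`. -/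
def mInterval {X : Type*} [MetricSpace X] (a b : X) : Set X :=
  {x : X | dist a x + dist x b = dist a b}

/-- A median space: every triple of points has a unique median point. -/
def IsMedianSpace (X : Type*) [MetricSpace X] : Prop :=
  ∀ a b c : X, ∃! m : X,
    m ∈ mInterval a b ∩ mInterval b c ∩ mInterval a c

/-- A subset is (median) convex if it contains the interval between any two of its points. -/
def MConvex {X : Type*} [MetricSpace X] (C : Set X) : Prop :=
  ∀ a ∈ C, ∀ b ∈ C, mInterval a b ⊆ C

/-- A halfspace: a convex subset with convex complement. -/
def IsHalfspace {X : Type*} [MetricSpace X] (h : Set X) : Prop :=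
  MConvex h ∧ MConvex hᶜ

/-- Two subsets are transverse if the four pairwise intersections of them and
their complements are all nonempty. -/
def TransverseSets {X : Type*} (h₁ h₂ : Set X) : Prop :=
  (h₁ ∩ h₂).Nonempty ∧ (h₁ᶜ ∩ h₂).Nonempty ∧ (h₁ ∩ h₂ᶜ).Nonempty ∧ (h₁ᶜ ∩ h₂ᶜ).Nonempty

/-- `X` has rank `n`: there are `n` pairwise transverse halfspaces but not `n+1`. -/
def HasMedianRank (X : Type*) [MetricSpace X] (n : ℕ) : Prop :=
  (∃ h : Fin n → Set X, (∀ i, IsHalfspace (h i)) ∧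
    ∀ i j, i ≠ j → TransverseSets (h i) (h j)) ∧
  ¬ ∃ h : Fin (n + 1) → Set X, (∀ i, IsHalfspace (h i)) ∧
    ∀ i j, i ≠ j → TransverseSets (h i) (h j)

/-- Median convex hull: intersection of all convex subsets containing `A`. -/
def mConvexHull {X : Type*} [MetricSpace X] (A : Set X) : Set X :=
  ⋂₀ {C : Set X | MConvex C ∧ A ⊆ C}

/-- The hyperplane bounding a halfspace `h`. -/
def mHyperplane {X : Type*} [MetricSpace X] (h : Set X) : Set X :=
  closure h ∩ closure hᶜ

/-- Depth of the halfspace `h` in the subset `A`: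
`sup { d(x, ĥ) | x ∈ h ∩ A }`. -/
noncomputable def mDepth {X : Type*} [MetricSpace X] (A h : Set X) : ℝ :=
  sSup ((fun x => Metric.infDist x (mHyperplane h)) '' (h ∩ A))

/-- `π` is the nearest-point projection onto `C`. -/
def IsNearestPointProj {X : Type*} [MetricSpace X] (C : Set X) (π : X → X) : Prop :=
  ∀ x : X, π x ∈ C ∧ dist x (π x) = Metric.infDist x C

/-- The halfspace `h` separates the points `x` and `y`. -/
def SeparatesPts {X : Type*} (h : Set X) (x y : X) : Prop :=
  (x ∈ h ∧ y ∈ hᶜ) ∨ (y ∈ h ∧ x ∈ hᶜ)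

section MedianBasics

variable {X : Type*} [MetricSpace X]

lemma mI_symm {a b x : X} (h : x ∈ mInterval a b) : x ∈ mInterval b a := by
  simp only [mInterval, Set.mem_ofPred_eq] at *
  rw [dist_comm b x, dist_comm x a, dist_comm b a]; linarith

lemma mI_left (a b : X) : a ∈ mInterval a b := by simp [mInterval]

lemma mI_right (a b : X) : b ∈ mInterval a b := by simp [mInterval]

lemma mI_self {a x : X} (h : x ∈ mInterval a a) : x = a := by
  simp only [mInterval, Set.mem_ofPred_eq, dist_self] at h
  have h1 := dist_nonneg (x := a) (y := x)
  have h2 := dist_nonneg (x := x) (y := a)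
  exact dist_eq_zero.1 (by linarith)

/-- `a - y - x - b` gives `y ∈ [a,b]`. -/
lemma mI_trans {a b x y : X} (hx : x ∈ mInterval a b) (hy : y ∈ mInterval a x) :
    y ∈ mInterval a b := by
  simp only [mInterval, Set.mem_ofPred_eq] at *
  have := dist_triangle a y b
  have := dist_triangle y x b
  linarith

lemma mI_trans' {a b x y : X} (hx : x ∈ mInterval a b) (hy : y ∈ mInterval a x) :
    x ∈ mInterval y b := by
  simp only [mInterval, Set.mem_ofPred_eq] at *
  have := dist_triangle a y b
  have := dist_triangle y x b
  linarith

/-- the median -/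
noncomputable def med (hm : IsMedianSpace X) (a b c : X) : X := (hm a b c).choose

lemma med_ab (hm : IsMedianSpace X) (a b c : X) : med hm a b c ∈ mInterval a b := (hm a b c).choose_spec.1.1.1
lemma med_bc (hm : IsMedianSpace X) (a b c : X) : med hm a b c ∈ mInterval b c := (hm a b c).choose_spec.1.1.2
lemma med_ac (hm : IsMedianSpace X) (a b c : X) : med hm a b c ∈ mInterval a c := (hm a b c).choose_spec.1.2

lemma med_unique (hm : IsMedianSpace X) {a b c x : X} (h1 : x ∈ mInterval a b) (h2 : x ∈ mInterval b c)
    (h3 : x ∈ mInterval a c) : x = med hm a b c :=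
  (hm a b c).choose_spec.2 x ⟨⟨h1, h2⟩, h3⟩

lemma med_inter (hm : IsMedianSpace X) {a b c x : X} (hb : x ∈ mInterval a b) (hc : x ∈ mInterval a c) :
    x ∈ mInterval a (med hm a b c) := by
  have h1 := med_ab hm x b c
  have h2 := med_bc hm x b c
  have h3 := med_ac hm x b c
  have e : med hm x b c = med hm a b c := by
    apply med_unique hm
    · exact mI_symm (mI_trans (mI_symm hb) (mI_symm h1))
    · exact h2
    · exact mI_symm (mI_trans (mI_symm hc) (mI_symm h3))
  rw [← e]
  exact mI_symm (mI_trans' (mI_symm hb) (mI_symm h1))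

/-- `med a b z` is the gate of `z` in `[a,b]`. -/
lemma med_gate (hm : IsMedianSpace X) {a b w : X} (z : X) (hw : w ∈ mInterval a b) :
    med hm a b z ∈ mInterval z w := by
  set p := med hm a b z with hp
  have hpab : p ∈ mInterval a b := med_ab hm a b z
  have hpaz : p ∈ mInterval a z := med_ac hm a b z
  have hpbz : p ∈ mInterval b z := med_bc hm a b z
  obtain ⟨u, hu1, hu2, hu3⟩ : ∃ u, u ∈ mInterval a z ∧ u ∈ mInterval z w ∧ u ∈ mInterval a w :=
    ⟨_, med_ab hm a z w, med_bc hm a z w, med_ac hm a z w⟩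
  obtain ⟨v, hv1, hv2, hv3⟩ : ∃ v, v ∈ mInterval b z ∧ v ∈ mInterval z w ∧ v ∈ mInterval b w :=
    ⟨_, med_ab hm b z w, med_bc hm b z w, med_ac hm b z w⟩
  have hup : u ∈ mInterval a p := med_inter hm (mI_trans hw hu3) hu1
  have hvp : v ∈ mInterval b p := by
    have h := med_inter hm (mI_trans (mI_symm hw) hv3) hv1
    have e : p = med hm b a z := med_unique hm (mI_symm hpab) hpaz hpbz
    rwa [← e] at h
  have k1 := mI_trans' hpaz hup
  have k2 := mI_trans' hpbz hvp
  have t1 := dist_triangle z p w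
  have t2 := dist_triangle p u w
  have t3 := dist_triangle p v w
  have t4 := dist_triangle a u b
  have t5 := dist_triangle u v b
  have t6 := dist_triangle u p v
  have t7 := dist_triangle u w v
  simp only [mInterval, Set.mem_ofPred_eq] at *
  have c1 := dist_comm z u
  have c2 := dist_comm z p
  have c3 := dist_comm z v
  have c4 := dist_comm p u
  have c5 := dist_comm w b
  have c6 := dist_comm p b
  have c7 := dist_comm v b
  have c8 := dist_comm w v
  have c9 := dist_comm p v
  linarith

lemma mI_convex (hm : IsMedianSpace X) (a b : X) : MConvex (mInterval a b) := by
  intro u hu v hv x hx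
  have h1 := med_gate hm x hu
  have h2 := med_gate hm x hv
  have h3 := med_inter hm h1 h2
  have e : x = med hm x u v := med_unique hm (mI_left _ _) hx (mI_left _ _)
  rw [← e] at h3
  rw [← mI_self h3]
  exact med_ab hm a b x

lemma med_lip (hm : IsMedianSpace X) (a b z z' : X) : dist (med hm a b z) (med hm a b z') ≤ dist z z' := by
  have h1 := med_gate hm z (med_ab hm a b z')
  have h2 := med_gate hm z' (med_ab hm a b z)
  simp only [mInterval, Set.mem_ofPred_eq] at h1 h2
  have := dist_triangle z z' (med hm a b z')
  have := dist_triangle z' z (med hm a b z)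
  rw [dist_comm z' z] at this
  rw [dist_comm (med hm a b z') (med hm a b z)] at h2
  linarith

lemma med_swap (hm : IsMedianSpace X) (a b z : X) : med hm a b z = med hm b z a :=
  med_unique hm (med_bc hm a b z) (mI_symm (med_ac hm a b z)) (mI_symm (med_ab hm a b z))

lemma med_lip2 (hm : IsMedianSpace X) (a b a' b' z : X) :
    dist (med hm a b z) (med hm a' b' z) ≤ dist a a' + dist b b' := by
  have h1 : dist (med hm a b z) (med hm a' b z) ≤ dist a a' := by
    rw [med_swap hm a b z, med_swap hm a' b z]; exact med_lip hm b z a a'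
  have h2 : dist (med hm a' b z) (med hm a' b' z) ≤ dist b b' := by
    rw [med_swap hm a' b z, med_swap hm a' b' z, med_swap hm b, med_swap hm b']
    exact med_lip hm _ _ _ _
  exact (dist_triangle _ _ _).trans (add_le_add h1 h2)

/-- Peano property. -/
lemma peano (hm : IsMedianSpace X) {a b u v x : X} (hu : u ∈ mInterval a b) (hx : x ∈ mInterval u v) :
    ∃ w ∈ mInterval b v, x ∈ mInterval a w := by
  refine ⟨med hm b v x, med_ab hm _ _ _, ?_⟩
  set w := med hm b v x
  have hy1 : med hm a x w ∈ mInterval x w := med_bc hm a x w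
  have hya : med hm a x w ∈ mInterval x a := mI_symm (med_ab hm a x w)
  set y := med hm a x w with hy
  have hyb : y ∈ mInterval x b := mI_trans (mI_symm (med_ac hm b v x)) hy1
  have hyv : y ∈ mInterval x v := mI_trans (mI_symm (med_bc hm b v x)) hy1
  have h1 := med_inter hm hya hyb
  have e : med hm x a b = med hm a b x := med_swap hm x a b
  rw [e] at h1
  have hyu : y ∈ mInterval x u := mI_trans (med_gate hm x hu) h1
  have h2 := med_inter hm hyu hyv
  have e2 : x = med hm x u v := med_unique hm (mI_left _ _) hx (mI_left _ _)
  rw [← e2] at h2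
  have := mI_self h2
  rw [← this]
  exact med_ac hm a x w

/-- Pasch property. -/
lemma pasch (hm : IsMedianSpace X) {a b c d z : X} (hc : c ∈ mInterval a z) (hd : d ∈ mInterval b z) :
    ∃ e, e ∈ mInterval b c ∧ e ∈ mInterval a d := by
  refine ⟨med hm b c d, med_ab hm _ _ _, ?_⟩
  have hebd := med_ac hm b c d
  have hecd := med_bc hm b c d
  set e := med hm b c d with he
  have hdez : d ∈ mInterval e z := mI_trans' hd hebd
  have f1 : med hm e d a ∈ mInterval e d := med_ab hm e d a
  have f2 : med hm e d a ∈ mInterval e a := med_ac hm e d a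
  have f3 : med hm e d a ∈ mInterval d a := med_bc hm e d a
  set f := med hm e d a
  have fz : f ∈ mInterval e z := mI_trans hdez f1
  have fg := med_inter hm f2 fz
  rw [med_swap hm e a z] at fg
  have fc : f ∈ mInterval e c := mI_trans (med_gate hm e hc) fg
  have h2 := med_inter hm fc f1
  have e2 : e = med hm e c d := med_unique hm (mI_left _ _) hecd (mI_left _ _)
  rw [← e2] at h2
  rw [← mI_self h2]
  exact mI_symm f3

lemma join_convex (hm : IsMedianSpace X) (a : X) {B : Set X} (hB : MConvex B) :
    MConvex {x | ∃ b ∈ B, x ∈ mInterval a b} := by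
  rintro u ⟨b, hb, hu⟩ v ⟨b', hb', hv⟩ x hx
  obtain ⟨w, hw, hxw⟩ := peano hm hu hx
  obtain ⟨b'', hb'', hwb⟩ := peano hm hv (mI_symm hw)
  exact ⟨b'', hB _ hb' _ hb hb'', mI_trans hwb hxw⟩

/-- Separation of disjoint convex sets by halfspaces. -/
lemma separation (hm : IsMedianSpace X) {A B : Set X} (hA : MConvex A) (hB : MConvex B) (hAB : Disjoint A B) :
    ∃ h, IsHalfspace h ∧ A ⊆ h ∧ Disjoint h B := by
  have key : ∀ A B : Set X, MConvex A → Disjoint A B →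
      ∃ h, A ⊆ h ∧ Maximal (fun s => MConvex s ∧ Disjoint s B) h := by
    intro A B hA hAB
    apply zorn_subset_nonempty {s | MConvex s ∧ Disjoint s B} _ A ⟨hA, hAB⟩
    intro c hc hch hne
    refine ⟨⋃₀ c, ⟨?_, ?_⟩, fun s hs => Set.subset_sUnion_of_mem hs⟩
    · rintro a ⟨s, hs, has⟩ b ⟨t, ht, hbt⟩
      rcases hch.total hs ht with h | h
      · exact ((hc ht).1 a (h has) b hbt).trans (Set.subset_sUnion_of_mem ht)
      · exact ((hc hs).1 a has b (h hbt)).trans (Set.subset_sUnion_of_mem hs)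
    · rw [Set.disjoint_sUnion_left]
      exact fun s hs => (hc hs).2
  obtain ⟨h, hAh, hmax⟩ := key A B hA hAB
  obtain ⟨k, hBk, kmax⟩ := key B h hB hmax.prop.2.symm
  have hkd : Disjoint h k := kmax.prop.2.symm
  have ext : ∀ (s t : Set X) (z : X), MConvex s → z ∉ s → s.Nonempty →
      (∀ s', MConvex s' → s ⊆ s' → Disjoint s' t → s' ⊆ s) →
      ∃ a ∈ s, ∃ c ∈ mInterval z a, c ∈ t := by
    intro s t z hs hz hne hmx
    by_contra hcon
    push Not at hcon
    have := hmx _ (join_convex hm z hs) (fun b hb => ⟨b, hb, mI_right _ _⟩) (by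
      rw [Set.disjoint_left]
      rintro x ⟨b, hb, hx⟩ hxt
      exact hcon b hb x hx hxt)
    obtain ⟨a, ha⟩ := hne
    exact hz (this ⟨a, ha, mI_left _ _⟩)
  have hmx1 : ∀ s', MConvex s' → h ⊆ s' → Disjoint s' k → s' ⊆ h := fun s' h1 h2 h3 =>
    hmax.2 ⟨h1, h3.mono_right hBk⟩ h2
  have hmx2 : ∀ s', MConvex s' → k ⊆ s' → Disjoint s' h → s' ⊆ k := fun s' h1 h2 h3 =>
    kmax.2 ⟨h1, h3⟩ h2
  have hsing : ∀ z : X, MConvex ({z} : Set X) := by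
    rintro z a rfl b rfl x hx
    exact mI_self hx
  have hcompl : hᶜ = k := by
    apply Set.Subset.antisymm
    · intro z hz
      by_contra hzk
      have hzh : z ∉ h := hz
      have hne : h.Nonempty := by
        by_contra hne
        rw [Set.not_nonempty_iff_eq_empty] at hne
        have := hmx1 {z} (hsing z) (by simp [hne]) (by simpa using hzk)
        exact hzh (this rfl)
      have kne : k.Nonempty := by
        by_contra hne
        rw [Set.not_nonempty_iff_eq_empty] at hne
        have := hmx2 {z} (hsing z) (by simp [hne]) (by simpa using hzh)
        exact hzk (this rfl)
      obtain ⟨a, ha, c, hc, hck⟩ := ext h k z hmax.prop.1 hzh hne hmx1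
      obtain ⟨b, hb, d, hd, hdh⟩ := ext k h z kmax.prop.1 hzk kne hmx2
      obtain ⟨e, he1, he2⟩ := pasch hm (mI_symm hc) (mI_symm hd)
      exact Set.disjoint_left.1 hkd (hmax.prop.1 _ ha _ hdh he2) (kmax.prop.1 _ hb _ hck he1)
    · exact hkd.symm.subset_compl_right
  refine ⟨h, ⟨hmax.prop.1, ?_⟩, hAh, hmax.prop.2⟩
  rw [hcompl]; exact kmax.prop.1

lemma hull_convex (A : Set X) : MConvex (mConvexHull A) := by
  intro a ha b hb x hx K hK
  exact hK.1 a (ha K hK) b (hb K hK) hx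

lemma subset_hull (A : Set X) : A ⊆ mConvexHull A := fun _ hx _ hK => hK.2 hx

lemma hull_min {A K : Set X} (h : A ⊆ K) (hK : MConvex K) : mConvexHull A ⊆ K :=
  fun _ hx => hx K ⟨hK, h⟩

lemma hull_mono {A B : Set X} (h : A ⊆ B) : mConvexHull A ⊆ mConvexHull B :=
  hull_min (h.trans (subset_hull B)) (hull_convex B)

lemma sing_convex (z : X) : MConvex ({z} : Set X) := by
  rintro a rfl b rfl x hx
  exact mI_self hx

lemma hull_finite {A : Set X} {x : X} (hx : x ∈ mConvexHull A) :
    ∃ F : Finset X, (F : Set X) ⊆ A ∧ x ∈ mConvexHull (F : Set X) := by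
  classical
  have := hull_min (A := A) (K := {x | ∃ F : Finset X, (F : Set X) ⊆ A ∧
    x ∈ mConvexHull (F : Set X)}) ?_ ?_ hx
  · exact this
  · intro a ha
    exact ⟨{a}, by simpa using ha, subset_hull _ (by simp)⟩
  · rintro a ⟨F, hF, ha⟩ b ⟨G, hG, hb⟩ y hy
    refine ⟨F ∪ G, by simp [hF, hG], ?_⟩
    exact hull_convex _ a (hull_mono (by simp) ha) b (hull_mono (by simp) hb) hy

lemma hull_dist_card (hm : IsMedianSpace X) {K : Set X} (hK : MConvex K) {r : ℝ} (F : Finset X) :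
    (∀ a ∈ F, ∃ k ∈ K, dist a k ≤ r) → ∀ x ∈ mConvexHull (F : Set X),
      ∃ k ∈ K, dist x k ≤ F.card * r := by
  classical
  induction F using Finset.induction_on with
  | empty =>
    intro _ x hx
    exact (hull_min (K := ∅) (by simp) (by intro a ha; exact ha.elim) hx).elim
  | insert a F ha ih =>
    intro hF x hx
    obtain ⟨ka, hka, hda⟩ := hF a (by simp)
    have ih' := ih (fun b hb => hF b (by simp [hb]))
    rcases F.eq_empty_or_nonempty with rfl | hne
    · have : x = a := hull_min (K := {a}) (by simp) (sing_convex a) hx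
      subst this
      exact ⟨ka, hka, by simpa using hda⟩
    · have : x ∈ {x | ∃ b ∈ mConvexHull (F : Set X), x ∈ mInterval a b} := by
        refine hull_min ?_ (join_convex hm a (hull_convex _)) hx
        intro y hy
        rcases Finset.mem_insert.1 (Finset.mem_coe.1 hy) with rfl | hy
        · obtain ⟨b, hb⟩ := hne
          exact ⟨b, subset_hull _ hb, mI_left _ _⟩
        · exact ⟨y, subset_hull _ hy, mI_right _ _⟩
      obtain ⟨b, hb, hxb⟩ := this
      obtain ⟨kb, hkb, hdb⟩ := ih' b hb
      refine ⟨med hm ka kb x, hK _ hka _ hkb (med_ab hm _ _ _), ?_⟩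
      have e : x = med hm a b x := med_unique hm hxb (mI_right _ _) (mI_right _ _)
      have h := med_lip2 hm a b ka kb x
      rw [← e] at h
      rw [Finset.card_insert_of_notMem ha]
      push_cast
      linarith

end MedianBasics

section MedianRank

lemma ramsey_pairs {ι : Type*} [Finite ι] (Q : ℕ → ℕ → ι → Prop)
    (h : ∀ i k, i < k → ∃ j, Q i k j) :
    ∃ j, ∃ g : ℕ → ℕ, StrictMono g ∧ ∀ a b, a < b → Q (g a) (g b) j := by
  have pigeon : ∀ P : ℕ → ι → Prop, (∀ᶠ k in (Filter.hyperfilter ℕ : Filter ℕ), ∃ j, P k j) →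
      ∃ j, ∀ᶠ k in (Filter.hyperfilter ℕ : Filter ℕ), P k j := by
    intro P hP
    by_contra hcon
    push Not at hcon
    have h1 : ∀ j, ∀ᶠ k in (Filter.hyperfilter ℕ : Filter ℕ), ¬ P k j := fun j =>
      Ultrafilter.eventually_not.2 (by simpa using hcon j)
    have h2 := Filter.eventually_all.2 h1
    obtain ⟨k, hk1, j, hk2⟩ := (h2.and hP).exists
    exact hk1 j hk2
  have hgt : ∀ i : ℕ, ∀ᶠ k in (Filter.hyperfilter ℕ : Filter ℕ), i < k := fun i =>
    Nat.hyperfilter_le_atTop (Filter.eventually_gt_atTop i)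
  have h1 : ∀ i, ∃ j, ∀ᶠ k in (Filter.hyperfilter ℕ : Filter ℕ), Q i k j := fun i =>
    pigeon (fun k j => Q i k j) ((hgt i).mono fun k hk => h i k hk)
  obtain ⟨j, hj⟩ := pigeon (fun i j => ∀ᶠ k in (Filter.hyperfilter ℕ : Filter ℕ), Q i k j)
    (Filter.Eventually.of_forall h1)
  obtain ⟨g, -, hg⟩ := exists_seq_of_forall_finset_exists
    (fun i => ∀ᶠ k in (Filter.hyperfilter ℕ : Filter ℕ), Q i k j)
    (fun i k => i < k ∧ Q i k j) (by
      intro s hs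
      have : ∀ᶠ k in (Filter.hyperfilter ℕ : Filter ℕ), ∀ x ∈ s, x < k ∧ Q x k j := by
        rw [Filter.eventually_all_finset]
        exact fun x hx => (hgt x).and (hs x hx)
      exact (hj.and this).exists)
  exact ⟨j, g, fun a b hab => (hg a b hab).1, fun a b hab => (hg a b hab).2⟩

variable {X : Type*} [MetricSpace X]

lemma antichain_false {n : ℕ} (hr : HasMedianRank X n) (f : Fin (n + 1) → Set X)
    (hf : ∀ i, IsHalfspace (f i)) (p q : X) (hp : ∀ i, p ∈ f i) (hq : ∀ i, q ∉ f i)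
    (hne : ∀ i j, i ≠ j → ∃ z, z ∈ f i ∧ z ∉ f j) : False := by
  refine hr.2 ⟨f, hf, fun i j hij => ⟨⟨p, hp i, hp j⟩, ?_, ?_, ⟨q, hq i, hq j⟩⟩⟩
  · obtain ⟨z, h1, h2⟩ := hne j i hij.symm
    exact ⟨z, h2, h1⟩
  · obtain ⟨z, h1, h2⟩ := hne i j hij
    exact ⟨z, h1, h2⟩

lemma caratheodory (hm : IsMedianSpace X) {n : ℕ} (hr : HasMedianRank X n) {A : Set X} {x : X}
    (hx : x ∈ mConvexHull A) :
    ∃ F : Finset X, (F : Set X) ⊆ A ∧ x ∈ mConvexHull (F : Set X) ∧ F.card ≤ n + 1 := by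
  classical
  have hex : ∃ k, ∃ F : Finset X, (F : Set X) ⊆ A ∧ x ∈ mConvexHull (F : Set X) ∧ F.card = k := by
    obtain ⟨F, h1, h2⟩ := hull_finite hx
    exact ⟨_, F, h1, h2, rfl⟩
  obtain ⟨F, hFA, hxF, hFc⟩ := Nat.find_spec hex
  refine ⟨F, hFA, hxF, ?_⟩
  by_contra hcard
  push Not at hcard
  have hne : F.Nonempty := Finset.card_pos.1 (by omega)
  obtain ⟨a, ha⟩ := hne
  have hsep : ∀ b ∈ F, ∃ h, IsHalfspace h ∧ x ∈ h ∧ b ∈ h ∧ ∀ c ∈ F, c ≠ b → c ∉ h := by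
    intro b hb
    have hxb : x ∉ mConvexHull ((F.erase b : Finset X) : Set X) := by
      intro hxb
      refine Nat.find_min hex (m := (F.erase b).card) ?_ ⟨_, ?_, hxb, rfl⟩
      · rw [← hFc]; exact Finset.card_erase_lt_of_mem hb
      · exact (Finset.coe_subset.2 (Finset.erase_subset b F)).trans hFA
    obtain ⟨h, hh, hxh, hd⟩ := separation hm (sing_convex x) (hull_convex _)
      (Set.disjoint_singleton_left.2 hxb)
    have hout : ∀ c ∈ F, c ≠ b → c ∉ h := fun c hc hcb hch =>
      Set.disjoint_left.1 hd hch (subset_hull _ (by simp [hc, hcb]))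
    refine ⟨h, hh, hxh rfl, ?_, hout⟩
    by_contra hbh
    have : mConvexHull (F : Set X) ⊆ hᶜ := by
      refine hull_min ?_ hh.2
      intro c hc
      by_cases hcb : c = b
      · subst hcb; exact hbh
      · exact hout c hc hcb
    exact this hxF (hxh rfl)
  choose! h hh hxh hbh hout using hsep
  have : Nonempty (Fin (n + 1) ↪ (F.erase a : Finset X)) := by
    apply Function.Embedding.nonempty_of_card_le
    simp only [Fintype.card_fin, Fintype.card_coe, Finset.card_erase_of_mem ha]
    omega
  obtain ⟨e⟩ := this
  have heF : ∀ i, (e i : X) ∈ F := fun i => Finset.mem_of_mem_erase (e i).2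
  have hea : ∀ i, (e i : X) ≠ a := fun i => Finset.ne_of_mem_erase (e i).2
  refine antichain_false hr (fun i => h (e i)) (fun i => hh _ (heF i)) x a
    (fun i => hxh _ (heF i)) (fun i => hout _ (heF i) a ha (hea i).symm) ?_
  intro i j hij
  refine ⟨e i, hbh _ (heF i), hout _ (heF j) _ (heF i) ?_⟩
  intro heq
  exact hij (e.injective (Subtype.ext heq))

lemma hull_dist (hm : IsMedianSpace X) {n : ℕ} (hr : HasMedianRank X n) {A K : Set X}
    (hK : MConvex K) {r : ℝ} (hr0 : 0 ≤ r) (hA : ∀ a ∈ A, ∃ k ∈ K, dist a k ≤ r) {x : X}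
    (hx : x ∈ mConvexHull A) : ∃ k ∈ K, dist x k ≤ (n + 1) * r := by
  obtain ⟨F, hFA, hxF, hc⟩ := caratheodory hm hr hx
  obtain ⟨k, hk, hd⟩ := hull_dist_card hm hK F (fun a ha => hA a (hFA ha)) x hxF
  refine ⟨k, hk, hd.trans ?_⟩
  have : (F.card : ℝ) ≤ n + 1 := by exact_mod_cast hc
  exact mul_le_mul_of_nonneg_right this hr0

lemma hull_ball (hm : IsMedianSpace X) {n : ℕ} (hr : HasMedianRank X n) {y x : X}
    {r : ℝ} (hr0 : 0 ≤ r) (hx : x ∈ mConvexHull (Metric.closedBall y r)) :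
    dist x y ≤ (n + 1) * r := by
  obtain ⟨k, hk, hd⟩ := hull_dist hm hr (sing_convex y) hr0
    (A := Metric.closedBall y r) (fun a ha => ⟨y, rfl, ha⟩) hx
  rw [Set.mem_singleton_iff] at hk
  rwa [hk] at hd

/-- A halfspace containing a ball and missing a convex set far from the centre. -/
lemma sep_ball (hm : IsMedianSpace X) {n : ℕ} (hr : HasMedianRank X n) {y : X} {K : Set X}
    (hK : MConvex K) {r : ℝ} (hr0 : 0 ≤ r) (hd : ∀ k ∈ K, (n + 1) * r < dist y k) :
    ∃ h, IsHalfspace h ∧ Metric.closedBall y r ⊆ h ∧ ∀ k ∈ K, k ∉ h := by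
  obtain ⟨h, hh, h1, h2⟩ := separation hm (hull_convex (Metric.closedBall y r)) hK (by
    rw [Set.disjoint_left]
    intro z hz hzK
    have := hull_ball hm hr hr0 hz
    have := hd z hzK
    rw [dist_comm] at this
    linarith)
  exact ⟨h, hh, (subset_hull _).trans h1, fun k hk hkh => Set.disjoint_left.1 h2 hkh hk⟩

/-- Thickening. -/
lemma sep_thick (hm : IsMedianSpace X) {n : ℕ} (hr : HasMedianRank X n) {y : X} {h0 : Set X}
    (hh0 : IsHalfspace h0) {r R : ℝ} (hr0 : 0 ≤ r) (hrR : 2 * ((n + 1) * r) ≤ R)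
    (hb : Metric.closedBall y R ⊆ h0) :
    ∃ h, IsHalfspace h ∧ Metric.closedBall y r ⊆ h ∧ h ⊆ h0 ∧ ∀ u ∈ h, ∀ v ∉ h0, r < dist u v := by
  obtain ⟨h, hh, h1, h2⟩ := separation hm (hull_convex (Metric.closedBall y r))
    (hull_convex {z | ∃ v ∈ h0ᶜ, dist z v ≤ r}) (by
    rw [Set.disjoint_left]
    intro z hz hzK
    have a1 := hull_ball hm hr hr0 hz
    obtain ⟨v, hv, a2⟩ := hull_dist hm hr hh0.2 hr0 (fun a ha => ha) hzK
    apply hv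
    apply hb
    rw [Metric.mem_closedBall]
    have := dist_triangle v z y
    rw [dist_comm v z] at this
    linarith)
  have key : ∀ u ∈ h, ∀ v ∉ h0, r < dist u v := by
    intro u hu v hv
    by_contra hcon
    exact Set.disjoint_left.1 h2 hu (subset_hull _ ⟨v, hv, not_lt.1 hcon⟩)
  refine ⟨h, hh, (subset_hull _).trans h1, ?_, key⟩
  intro u hu
  by_contra hu0
  have := key u hu u hu0
  rw [dist_self] at this
  linarith

lemma reduce {n : ℕ} (hr : HasMedianRank X n) (k : ℕ) (h : ℕ → Set X) (p q : X)
    (hh : ∀ i < k, IsHalfspace (h i) ∧ p ∈ h i ∧ q ∉ h i) :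
    ∃ e : Fin n → Set X, ∀ i < k, ∃ j, (∃ i' < k, e j = h i') ∧ e j ⊆ h i := by
  classical
  set G : Finset (Set X) := (Finset.range k).image h with hG
  set M : Finset (Set X) := G.filter (fun g => ∀ g' ∈ G, g' ⊆ g → g' = g) with hM
  have hGm : ∀ g ∈ G, ∃ i < k, g = h i := by
    intro g hg
    obtain ⟨i, hi, rfl⟩ := Finset.mem_image.1 hg
    exact ⟨i, Finset.mem_range.1 hi, rfl⟩
  have hMG : ∀ g ∈ M, g ∈ G := fun g hg => (Finset.mem_filter.1 hg).1
  have hcard : M.card ≤ n := by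
    by_contra hc
    push Not at hc
    have : Nonempty (Fin (n + 1) ↪ M) := by
      apply Function.Embedding.nonempty_of_card_le
      simp only [Fintype.card_fin, Fintype.card_coe]
      omega
    obtain ⟨e⟩ := this
    have hprop : ∀ i, IsHalfspace (e i : Set X) ∧ p ∈ (e i : Set X) ∧ q ∉ (e i : Set X) := by
      intro i
      obtain ⟨i', hi', he⟩ := hGm _ (hMG _ (e i).2)
      rw [he]; exact hh i' hi'
    refine antichain_false hr (fun i => (e i : Set X)) (fun i => (hprop i).1) p q
      (fun i => (hprop i).2.1) (fun i => (hprop i).2.2) ?_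
    intro i j hij
    by_contra hcon
    push Not at hcon
    have := (Finset.mem_filter.1 (e j).2).2 _ (hMG _ (e i).2) hcon
    exact hij (e.injective (Subtype.ext this))
  have : Nonempty (M ↪ Fin n) := by
    apply Function.Embedding.nonempty_of_card_le
    simpa using hcard
  obtain ⟨φ⟩ := this
  refine ⟨Function.extend φ Subtype.val (fun _ => ∅), ?_⟩
  intro i hi
  have hiG : h i ∈ G := Finset.mem_image.2 ⟨i, Finset.mem_range.2 hi, rfl⟩
  obtain ⟨m, hmi, hmin⟩ := G.exists_le_minimal hiG
  have hmM : m ∈ M := by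
    refine Finset.mem_filter.2 ⟨hmin.1, fun g' hg' hle => ?_⟩
    exact Set.Subset.antisymm hle (hmin.2 hg' hle)
  refine ⟨φ ⟨m, hmM⟩, ?_⟩
  rw [φ.injective.extend_apply]
  exact ⟨hGm m hmin.1, hmi⟩

lemma gather {n : ℕ} (hr : HasMedianRank X n) (x : X) (y : ℕ → X) {R : ℝ} (hR : 0 ≤ R)
    (H : ∀ i k, i < k → ∃ h, IsHalfspace h ∧ Metric.closedBall (y k) R ⊆ h ∧ x ∉ h ∧ y i ∉ h) :
    ∃ g : ℕ → ℕ, StrictMono g ∧ ∃ h : ℕ → Set X, ∀ k, IsHalfspace (h k) ∧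
      Metric.closedBall (y (g k)) R ⊆ h k ∧ x ∉ h k ∧ ∀ i < k, y (g i) ∉ h k := by
  choose! h h1 h2 h3 h4 using H
  have hy : ∀ k, y k ∈ Metric.closedBall (y k) R := fun k => Metric.mem_closedBall_self hR
  have := fun k => reduce hr k (fun i => h i k) (y k) x
    (fun i hi => ⟨h1 i k hi, h2 i k hi (hy k), h3 i k hi⟩)
  choose e he using this
  obtain ⟨j, g, hg, hQ⟩ := ramsey_pairs (fun i k (j : Fin n) => IsHalfspace (e k j) ∧
      Metric.closedBall (y k) R ⊆ e k j ∧ x ∉ e k j ∧ y i ∉ e k j) (by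
    intro i k hik
    obtain ⟨j, ⟨i', hi', hj⟩, hsub⟩ := he k i hik
    refine ⟨j, ?_, ?_, ?_, fun hy => h4 i k hik (hsub hy)⟩
    · rw [hj]; exact h1 i' k hi'
    · rw [hj]; exact h2 i' k hi'
    · rw [hj]; exact h3 i' k hi')
  refine ⟨fun k => g (k + 1), fun a b hab => hg (by omega), fun k => e (g (k + 1)) j, fun k => ?_⟩
  obtain ⟨q1, q2, q3, -⟩ := hQ 0 (k + 1) (by omega)
  exact ⟨q1, q2, q3, fun i hi => (hQ (i + 1) (k + 1) (by omega)).2.2.2⟩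

lemma chain_bound (hm : IsMedianSpace X) {x y : X} {r : ℝ} (L : ℕ) (p : ℕ → X)
    (h0 h1 : ℕ → Set X) (hp : ∀ k ≤ L, p k ∈ mInterval x y) (hh0 : ∀ k ≤ L, IsHalfspace (h0 k))
    (hh1 : ∀ k ≤ L, IsHalfspace (h1 k)) (hx : ∀ k ≤ L, x ∉ h1 k) (hp1 : ∀ k ≤ L, p k ∈ h1 k)
    (hp0 : ∀ i k, i < k → k ≤ L → p i ∉ h0 k)
    (hd : ∀ k ≤ L, ∀ u ∈ h1 k, ∀ v ∉ h0 k, r < dist u v) : L * r ≤ dist x y := by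
  have key : ∀ k ≤ L, ∃ t, t ∈ mInterval x y ∧ (∀ j, k < j → j ≤ L → t ∉ h0 j) ∧
      k * r ≤ dist x t := by
    intro k
    induction k with
    | zero =>
      intro _
      exact ⟨p 0, hp 0 (by omega), fun j hj hjL => hp0 0 j hj hjL, by simp⟩
    | succ k ih =>
      intro hk
      obtain ⟨t, ht, hout, hdt⟩ := ih (by omega)
      have a1 := med_ab hm y t (p (k + 1))
      have a2 := med_bc hm y t (p (k + 1))
      have a3 := med_ac hm y t (p (k + 1))
      set s := med hm y t (p (k + 1))
      have hsx : s ∈ mInterval x y := mI_symm (mI_trans (mI_symm ht) a1)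
      have hts : t ∈ mInterval x s := mI_symm (mI_trans' (mI_symm ht) a1)
      have hps : p (k + 1) ∈ mInterval x s := mI_symm (mI_trans' (mI_symm (hp _ hk)) a3)
      have hs1 : s ∈ h1 (k + 1) := by
        by_contra hcon
        exact (hh1 _ hk).2 x (hx _ hk) s hcon hps (hp1 _ hk)
      refine ⟨s, hsx, fun j hj hjL => ?_, ?_⟩
      · exact (hh0 j hjL).2 t (hout j (by omega) hjL) _ (hp0 _ j hj hjL) a2
      · have := hd _ hk s hs1 t (hout _ (by omega) hk)
        simp only [mInterval, Set.mem_ofPred_eq] at hts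
        rw [dist_comm] at this
        push_cast
        linarith
  obtain ⟨t, ht, -, hdt⟩ := key L le_rfl
  simp only [mInterval, Set.mem_ofPred_eq] at ht
  have := dist_nonneg (x := t) (y := y)
  linarith

end MedianRank

section MedianMain

variable {X : Type*} [MetricSpace X]

lemma interval_core (hm : IsMedianSpace X) {n : ℕ} (hr : HasMedianRank X n) {x y : X}
    (p : ℕ → X) (hp : ∀ k, p k ∈ mInterval x y) {R : ℝ} (hR : 0 < R)
    (H : ∀ i k, i < k → ∃ h, IsHalfspace h ∧ Metric.closedBall (p k) R ⊆ h ∧ x ∉ h ∧ p i ∉ h) :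
    False := by
  obtain ⟨g, hg, h, hh⟩ := gather hr x p hR.le H
  have hn : (0 : ℝ) < n + 1 := by positivity
  set r := R / (2 * (n + 1)) with hrdef
  have hr0 : 0 < r := by positivity
  have hrR : 2 * ((n + 1) * r) ≤ R := by
    rw [hrdef]; apply le_of_eq; field_simp
  choose h1 a1 a2 a3 a4 using fun k => sep_thick hm hr (hh k).1 hr0.le hrR (hh k).2.1
  have key : ∀ L : ℕ, L * r ≤ dist x y := fun L =>
    chain_bound hm L (fun k => p (g k)) h h1 (fun k _ => hp _) (fun k _ => (hh k).1)
      (fun k _ => a1 k) (fun k _ hx => (hh k).2.2.1 (a3 k hx))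
      (fun k _ => a2 k (Metric.mem_closedBall_self hr0.le))
      (fun i k hik _ => (hh k).2.2.2 i hik) (fun k _ => a4 k)
  obtain ⟨L, hL⟩ := exists_nat_gt (dist x y / r)
  rw [div_lt_iff₀ hr0] at hL
  exact absurd (key L) (not_le.2 hL)

lemma interval_tb (hm : IsMedianSpace X) {n : ℕ} (hr : HasMedianRank X n) (x y : X) :
    TotallyBounded (mInterval x y) := by
  rw [Metric.totallyBounded_iff]
  by_contra hcon
  push Not at hcon
  obtain ⟨ε, hε, hcov⟩ := hcon
  obtain ⟨p, hp, hsep⟩ := exists_seq_of_forall_finset_exists (fun z => z ∈ mInterval x y)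
    (fun a b => ε ≤ dist b a) (by
      intro s _
      obtain ⟨z, hz, hz2⟩ := Set.not_subset.1 (hcov s s.finite_toSet)
      refine ⟨z, hz, fun a ha => ?_⟩
      by_contra hlt
      exact hz2 (Set.mem_biUnion (x := a) ha (by simpa using hlt)))
  have hn : (0 : ℝ) < n + 1 := by positivity
  set R := ε / (2 * (n + 1)) with hRdef
  have hR : 0 < R := by positivity
  have hRe : (n + 1) * R = ε / 2 := by rw [hRdef]; field_simp
  have hh : ∀ i k, i < k → ∃ h, IsHalfspace h ∧ Metric.closedBall (p k) R ⊆ h ∧ p i ∉ h := by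
    intro i k hik
    obtain ⟨h, b1, b2, b3⟩ := sep_ball hm hr (y := p k) (sing_convex (p i)) hR.le (by
      rintro _ rfl
      have := hsep i k hik
      rw [hRe]; linarith)
    exact ⟨h, b1, b2, b3 _ rfl⟩
  obtain ⟨b, g, hg, hQ⟩ := ramsey_pairs (fun i k (b : Bool) => ∃ h, IsHalfspace h ∧
    Metric.closedBall (p k) R ⊆ h ∧ (bif b then x else y) ∉ h ∧ p i ∉ h) (by
      intro i k hik
      obtain ⟨h, b1, b2, b3⟩ := hh i k hik
      by_cases hx : x ∈ h
      · refine ⟨false, h, b1, b2, ?_, b3⟩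
        intro hy
        exact b3 (b1.1 x hx y hy (hp i))
      · exact ⟨true, h, b1, b2, hx, b3⟩)
  cases b with
  | true => exact interval_core hm hr (x := x) (y := y) (fun k => p (g k)) (fun k => hp _) hR hQ
  | false =>
    exact interval_core hm hr (x := y) (y := x) (fun k => p (g k)) (fun k => mI_symm (hp _)) hR hQ

lemma two_one [CompleteSpace X] (hm : IsMedianSpace X) {n : ℕ} (hr : HasMedianRank X n)
    {C : Set X} (hCne : C.Nonempty) (hCcl : IsClosed C)
    (H : ∀ x₀ ∈ C, ∀ ε : ℝ, 0 < ε → ∃ (k : ℕ) (x : Fin k → X), (∀ i, x i ∈ C) ∧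
        ∀ y ∈ C, ∃ i, Metric.infDist y (mInterval x₀ (x i)) ≤ ε) : IsCompact C := by
  rw [isCompact_iff_totallyBounded_isComplete]
  refine ⟨?_, hCcl.isComplete⟩
  obtain ⟨x0, hx0⟩ := hCne
  rw [Metric.totallyBounded_iff]
  intro ε hε
  obtain ⟨k, x, hx, hC⟩ := H x0 hx0 (ε / 4) (by positivity)
  have := fun i => Metric.totallyBounded_iff.1 (interval_tb hm hr x0 (x i)) (ε / 2) (by positivity)
  choose t ht hcov using this
  refine ⟨⋃ i, t i, Set.finite_iUnion ht, ?_⟩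
  intro y hy
  obtain ⟨i, hi⟩ := hC y hy
  obtain ⟨z, hz, hyz⟩ := (Metric.infDist_lt_iff ⟨x0, mI_left x0 (x i)⟩).1
    (lt_of_le_of_lt hi (show ε / 4 < ε / 2 by linarith))
  obtain ⟨w, hw, hzw⟩ := Set.mem_iUnion₂.1 (hcov i hz)
  refine Set.mem_biUnion (Set.mem_iUnion.2 ⟨i, hw⟩) ?_
  rw [Metric.mem_ball] at *
  have := dist_triangle y z w
  linarith

lemma one_two {C : Set X} (hC : IsCompact C) :
    ∀ x₀ ∈ C, ∀ ε : ℝ, 0 < ε → ∃ (k : ℕ) (x : Fin k → X), (∀ i, x i ∈ C) ∧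
        ∀ y ∈ C, ∃ i, Metric.infDist y (mInterval x₀ (x i)) ≤ ε := by
  intro x0 _ ε hε
  obtain ⟨t, htC, htf, hcov⟩ := hC.finite_cover_balls hε
  obtain ⟨k, f, -, hf⟩ := htf.fin_param
  refine ⟨k, f, fun i => htC (hf ▸ Set.mem_range_self i), fun y hy => ?_⟩
  obtain ⟨z, hz, hyz⟩ := Set.mem_iUnion₂.1 (hcov hy)
  obtain ⟨i, rfl⟩ : z ∈ Set.range f := hf ▸ hz
  exact ⟨i, (Metric.infDist_le_dist_of_mem (mI_right _ _)).trans (Metric.mem_ball.1 hyz).le⟩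

lemma interval_preconnected [ConnectedSpace X] (hm : IsMedianSpace X) (a b : X) :
    IsPreconnected (mInterval a b) := by
  have hc : Continuous (fun z => med hm a b z) :=
    (LipschitzWith.of_dist_le_mul (K := 1) (by
      intro z z'; simpa using med_lip hm a b z z')).continuous
  have h1 := isPreconnected_range hc
  convert h1 using 1
  ext z
  constructor
  · intro hz
    exact ⟨z, (med_unique hm hz (mI_right _ _) (mI_right _ _)).symm⟩
  · rintro ⟨w, rfl⟩
    exact med_ab hm a b w

lemma hyperplane_cross [ConnectedSpace X] (hm : IsMedianSpace X) {h : Set X} {x v : X}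
    (hx : x ∈ h) (hv : v ∉ h) : ∃ z ∈ mHyperplane h, dist x z ≤ dist x v := by
  have hcon := (interval_preconnected hm x v)
  have h2 := isPreconnected_closed_iff.1 hcon (closure h) (closure hᶜ) isClosed_closure
    isClosed_closure (by
      intro z _
      by_cases hz : z ∈ h
      · exact Or.inl (subset_closure hz)
      · exact Or.inr (subset_closure hz))
    ⟨x, mI_left _ _, subset_closure hx⟩ ⟨v, mI_right _ _, subset_closure hv⟩
  obtain ⟨z, hz, hzz⟩ := h2
  refine ⟨z, hzz, ?_⟩
  simp only [mInterval, Set.mem_ofPred_eq] at hz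
  have := dist_nonneg (x := z) (y := v)
  linarith

lemma two_three [ConnectedSpace X] (hm : IsMedianSpace X) {n : ℕ} (hr : HasMedianRank X n)
    {C : Set X} (hCne : C.Nonempty)
    (H : ∀ x₀ ∈ C, ∀ ε : ℝ, 0 < ε → ∃ (k : ℕ) (x : Fin k → X), (∀ i, x i ∈ C) ∧
        ∀ y ∈ C, ∃ i, Metric.infDist y (mInterval x₀ (x i)) ≤ ε) :
    ∀ ε : ℝ, 0 < ε → ∀ H : Set (Set X),
        (∀ h ∈ H, IsHalfspace h ∧ (h ∩ C).Nonempty ∧ (hᶜ ∩ C).Nonempty ∧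
          ε < mDepth (mConvexHull C) h) →
        H.Pairwise (Disjoint · ·) → H.Finite := by
  intro ε hε HH hHH hdisj
  obtain ⟨x0, hx0⟩ := hCne
  have hn : (0 : ℝ) < n + 1 := by positivity
  set r := ε / (n + 1) with hrdef
  have hr0 : 0 < r := by positivity
  have hre : (n + 1) * r = ε := by rw [hrdef]; field_simp
  obtain ⟨k, x, hx, hC⟩ := H x0 hx0 (r / 2) (by positivity)
  have hpt : ∀ z : X, {h ∈ HH | z ∈ h}.Finite := by
    intro z
    apply Set.Subsingleton.finite
    rintro h ⟨h1, h2⟩ h' ⟨h1', h2'⟩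
    by_contra hne
    exact Set.disjoint_left.1 (hdisj h1 h1' hne) h2 h2'
  refine ((hpt x0).union (Set.finite_iUnion fun i => hpt (x i))).subset ?_
  intro h hh
  by_cases hx0h : x0 ∈ h
  · exact Or.inl ⟨hh, hx0h⟩
  right
  obtain ⟨hhalf, hne, -, hdep⟩ := hHH h hh
  obtain ⟨_, ⟨u, ⟨huh, huC⟩, rfl⟩, hu⟩ := exists_lt_of_lt_csSup (by
    obtain ⟨c, hc1, hc2⟩ := hne
    exact ⟨_, c, ⟨hc1, subset_hull _ hc2⟩, rfl⟩) hdep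
  have hfar : ∀ v ∉ h, ε < dist u v := by
    intro v hv
    obtain ⟨z, hz, hd⟩ := hyperplane_cross hm huh hv
    have := Metric.infDist_le_dist_of_mem (x := u) hz
    simp only at hu
    linarith
  have : ∃ c ∈ C, ∀ v ∉ h, r < dist c v := by
    by_contra hcon
    push Not at hcon
    obtain ⟨v, hv, hd⟩ := hull_dist hm hr hhalf.2 hr0.le
      (fun c hc => by obtain ⟨v, hv, hd⟩ := hcon c hc; exact ⟨v, hv, hd⟩) huC
    rw [hre] at hd
    exact absurd (hfar v hv) (not_lt.2 hd)
  obtain ⟨c, hc, hcv⟩ := this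
  obtain ⟨i, hi⟩ := hC c hc
  obtain ⟨z, hz, hcz⟩ := (Metric.infDist_lt_iff ⟨x0, mI_left x0 (x i)⟩).1
    (lt_of_le_of_lt hi (show r / 2 < r by linarith))
  have hzh : z ∈ h := by
    by_contra hzh
    exact absurd (hcv z hzh) (not_lt.2 hcz.le)
  refine Set.mem_iUnion.2 ⟨i, hh, ?_⟩
  by_contra hxi
  exact hhalf.2 x0 hx0h _ hxi hz hzh

lemma depth_lower [ConnectedSpace X] (hm : IsMedianSpace X) {n : ℕ} (hr : HasMedianRank X n)
    {C : Set X} (hCbd : Bornology.IsBounded C) {h : Set X} {x y : X} {r : ℝ} (hr0 : 0 ≤ r)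
    (hx : x ∈ C) (hxh : x ∉ h) (hy : y ∈ C) (hb : Metric.closedBall y r ⊆ h) :
    r ≤ mDepth (mConvexHull C) h := by
  have hyh : y ∈ h := hb (Metric.mem_closedBall_self hr0)
  obtain ⟨z0, hz0, -⟩ := hyperplane_cross hm hyh hxh
  obtain ⟨D, hD⟩ := hCbd.subset_closedBall x
  have hD0 : 0 ≤ D := by simpa using hD hx
  have hbdd : BddAbove ((fun x => Metric.infDist x (mHyperplane h)) '' (h ∩ mConvexHull C)) := by
    refine ⟨(n + 1) * D + dist x z0, ?_⟩
    rintro _ ⟨u, ⟨-, hu⟩, rfl⟩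
    have h1 := hull_ball hm hr hD0 (hull_mono hD hu)
    have h2 := Metric.infDist_le_dist_of_mem (x := u) hz0
    have h3 := dist_triangle u x z0
    simp only
    linarith
  refine le_trans ?_ (le_csSup hbdd ⟨y, ⟨hyh, subset_hull _ hy⟩, rfl⟩)
  refine (Metric.le_infDist ⟨z0, hz0⟩).2 ?_
  intro z hz
  have hsub : hᶜ ⊆ {w | r ≤ dist y w} := by
    intro w hw
    by_contra hlt
    refine hw (hb ?_)
    rw [Metric.mem_closedBall, dist_comm]
    exact (not_le.1 hlt).le
  have hcl : IsClosed {w : X | r ≤ dist y w} :=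
    isClosed_le continuous_const (continuous_const.dist continuous_id)
  exact closure_minimal hsub hcl hz.2

lemma three_two [ConnectedSpace X] (hm : IsMedianSpace X) {n : ℕ} (hr : HasMedianRank X n)
    {C : Set X} (hCbd : Bornology.IsBounded C)
    (H : ∀ ε : ℝ, 0 < ε → ∀ H : Set (Set X),
        (∀ h ∈ H, IsHalfspace h ∧ (h ∩ C).Nonempty ∧ (hᶜ ∩ C).Nonempty ∧
          ε < mDepth (mConvexHull C) h) →
        H.Pairwise (Disjoint · ·) → H.Finite) :
    ∀ x₀ ∈ C, ∀ ε : ℝ, 0 < ε → ∃ (k : ℕ) (x : Fin k → X), (∀ i, x i ∈ C) ∧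
        ∀ y ∈ C, ∃ i, Metric.infDist y (mInterval x₀ (x i)) ≤ ε := by
  intro x0 hx0 ε hε
  by_contra hcon
  push Not at hcon
  obtain ⟨y, hyC, hsep⟩ := exists_seq_of_forall_finset_exists (fun z => z ∈ C)
    (fun a b => ε < Metric.infDist b (mInterval x0 a)) (by
      intro s hs
      obtain ⟨k, f, -, hf⟩ := s.finite_toSet.fin_param
      obtain ⟨z, hz, hz2⟩ := hcon k f (fun i => hs _ (by
        have : f i ∈ (s : Set X) := hf ▸ Set.mem_range_self i
        exact this))
      refine ⟨z, hz, fun a ha => ?_⟩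
      obtain ⟨i, rfl⟩ : a ∈ Set.range f := hf ▸ ha
      exact hz2 i)
  have hn : (0 : ℝ) < n + 1 := by positivity
  set R := ε / (n + 1) with hRdef
  have hR : 0 < R := by positivity
  have hRe : (n + 1) * R = ε := by rw [hRdef]; field_simp
  obtain ⟨g, hg, h0, hh0⟩ := gather hr x0 y hR.le (by
    intro i k hik
    obtain ⟨h, b1, b2, b3⟩ := sep_ball hm hr (y := y k) (mI_convex hm x0 (y i)) hR.le (by
      intro z hz
      rw [hRe]
      exact lt_of_lt_of_le (hsep i k hik) (Metric.infDist_le_dist_of_mem hz))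
    exact ⟨h, b1, b2, b3 _ (mI_left _ _), b3 _ (mI_right _ _)⟩)
  set r := R / (2 * (n + 1)) with hrdef
  have hr0 : 0 < r := by positivity
  have hrR : 2 * ((n + 1) * r) ≤ R := by
    rw [hrdef]; apply le_of_eq; field_simp
  choose h1 a1 a2 a3 a4 using fun k => sep_thick hm hr (hh0 k).1 hr0.le hrR (hh0 k).2.1
  have hin : ∀ k, y (g k) ∈ h1 k := fun k => a2 k (Metric.mem_closedBall_self hr0.le)
  have hx1 : ∀ k, x0 ∉ h1 k := fun k hx => (hh0 k).2.2.1 (a3 k hx)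
  have hout : ∀ i k, i < k → y (g i) ∉ h0 k := fun i k hik => (hh0 k).2.2.2 i hik
  -- trichotomy
  obtain ⟨c, f, hf, hQ⟩ := ramsey_pairs (fun i k (c : Fin 3) =>
      (c = 0 ∧ Disjoint (h1 i) (h1 k)) ∨ (c = 1 ∧ h1 k ⊆ h1 i) ∨
      (c = 2 ∧ TransverseSets (h1 i) (h1 k))) (by
    intro i k hik
    by_cases hd : Disjoint (h1 i) (h1 k)
    · exact ⟨0, Or.inl ⟨rfl, hd⟩⟩
    by_cases hs : h1 k ⊆ h1 i
    · exact ⟨1, Or.inr (Or.inl ⟨rfl, hs⟩)⟩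
    refine ⟨2, Or.inr (Or.inr ⟨rfl, Set.not_disjoint_iff_nonempty_inter.1 hd, ?_, ?_, ?_⟩)⟩
    · obtain ⟨z, hz1, hz2⟩ := Set.not_subset.1 hs
      exact ⟨z, hz2, hz1⟩
    · exact ⟨y (g i), hin i, fun hz => hout i k hik (a3 k hz)⟩
    · exact ⟨x0, hx1 i, hx1 k⟩)
  fin_cases c
  · -- disjoint
    have hd : ∀ i k, i < k → Disjoint (h1 (f i)) (h1 (f k)) := by
      intro i k hik
      simpa using hQ i k hik
    have hd' : ∀ i k, i ≠ k → Disjoint (h1 (f i)) (h1 (f k)) := by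
      intro i k hik
      rcases lt_or_gt_of_ne hik with h | h
      · exact hd i k h
      · exact (hd k i h).symm
    have hfin := H (r / 2) (by positivity) (Set.range fun k => h1 (f k)) (by
      rintro _ ⟨k, rfl⟩
      refine ⟨a1 _, ⟨_, hin _, hyC _⟩, ⟨x0, hx1 _, hx0⟩, ?_⟩
      have := depth_lower hm hr hCbd hr0.le hx0 (hx1 (f k)) (hyC (g (f k))) (a2 (f k))
      linarith) (by
      rintro _ ⟨i, rfl⟩ _ ⟨k, rfl⟩ hne
      exact hd' i k (fun e => hne (by rw [e])))
    refine (Set.infinite_range_of_injective ?_) hfin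
    intro i k hik
    by_contra hne
    have h2 := hd' i k hne
    simp only at hik
    rw [← hik] at h2
    exact Set.disjoint_left.1 h2 (hin (f i)) (hin (f i))
  · -- descending
    have hd : ∀ i k, i < k → h1 (f k) ⊆ h1 (f i) := by
      intro i k hik
      simpa using hQ i k hik
    obtain ⟨D, hD⟩ := hCbd.subset_closedBall x0
    obtain ⟨L, hL⟩ := exists_nat_gt (D / r)
    rw [div_lt_iff₀ hr0] at hL
    have hyL : y (g (f (L + 1))) ∈ h1 (f (L + 1)) := hin _
    have key := chain_bound hm (x := x0) (y := y (g (f (L + 1)))) (r := r) L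
      (fun k => med hm x0 (y (g (f k))) (y (g (f (L + 1))))) (fun k => h0 (f k))
      (fun k => h1 (f k)) (fun k _ => med_ac hm _ _ _) (fun k _ => (hh0 _).1) (fun k _ => a1 _)
      (fun k _ => hx1 _)
      (fun k hk => (a1 (f k)).1 _ (hin (f k)) _ (hd k (L + 1) (by omega) hyL) (med_bc hm _ _ _))
      (fun i k hik _ => (hh0 (f k)).1.2 x0 (hh0 (f k)).2.2.1 _ (hout (f i) (f k) (hf hik))
        (med_ab hm _ _ _))
      (fun k _ => a4 _)
    have := hD (hyC (g (f (L + 1))))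
    rw [Metric.mem_closedBall, dist_comm] at this
    linarith
  · -- transverse
    have ht : ∀ i k, i < k → TransverseSets (h1 (f i)) (h1 (f k)) := by
      intro i k hik
      simpa using hQ i k hik
    refine hr.2 ⟨fun i => h1 (f i), fun i => a1 _, fun i j hij => ?_⟩
    rcases lt_or_gt_of_ne hij with h | h
    · exact ht i j h
    · obtain ⟨t1, t2, t3, t4⟩ := ht j i h
      refine ⟨?_, ?_, ?_, ?_⟩
      · rwa [Set.inter_comm]
      · rwa [Set.inter_comm]
      · rwa [Set.inter_comm]
      · rwa [Set.inter_comm]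

end MedianMain

/-- Characterization of compactness of closed bounded subsets of a complete connected
median space of rank `n` via halfspaces. -/
theorem statement1 (X : Type*) [MetricSpace X] [CompleteSpace X] [ConnectedSpace X]
    (hmed : IsMedianSpace X) (n : ℕ) (hrank : HasMedianRank X n)
    (C : Set X) (hCne : C.Nonempty) (hCcl : IsClosed C) (hCbd : Bornology.IsBounded C) :
    List.TFAE [
      IsCompact C,
      ∀ x₀ ∈ C, ∀ ε : ℝ, 0 < ε → ∃ (k : ℕ) (x : Fin k → X), (∀ i, x i ∈ C) ∧
        ∀ y ∈ C, ∃ i, Metric.infDist y (mInterval x₀ (x i)) ≤ ε,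
      ∀ ε : ℝ, 0 < ε → ∀ H : Set (Set X),
        (∀ h ∈ H, IsHalfspace h ∧ (h ∩ C).Nonempty ∧ (hᶜ ∩ C).Nonempty ∧
          ε < mDepth (mConvexHull C) h) →
        H.Pairwise (Disjoint · ·) → H.Finite ] := by
  tfae_have 1 → 2 := one_two
  tfae_have 2 → 1 := two_one hmed hrank hCne hCcl
  tfae_have 2 → 3 := two_three hmed hrank hCne
  tfae_have 3 → 2 := three_two hmed hrank hCbd
  tfae_finish
end

section
/- Let X be a complete median space of rank n and let C be a nonempty closed convex subset of X. Then for every r > 0, the convex hull of the closed r-tubular neighbourhood N_r(C) := {x ∈ X | d(x,C) ≤ r} is contained in N_{n·r}(C). -/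
namespace MedAux

variable {X : Type*} [MetricSpace X]

/-- betweenness: `x` lies in the interval `[a,b]`. -/
def B (a x b : X) : Prop := dist a x + dist x b = dist a b

lemma B.symm {a x b : X} (h : B a x b) : B b x a := by
  unfold B at *
  rw [dist_comm b x, dist_comm x a, dist_comm b a]; linarith

lemma B.left (a b : X) : B a a b := by simp [B]
lemma B.right (a b : X) : B a b b := by simp [B]

lemma B.trans {a y x b : X} (h : B a x b) (k : B a y x) : B a y b := by
  unfold B at *
  linarith [dist_triangle a y b, dist_triangle y x b]

lemma B.shift {a y x b : X} (h : B a x b) (k : B a y x) : B y x b := by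
  unfold B at *
  linarith [dist_triangle a y b, dist_triangle y x b]

lemma B.cut {a x y b : X} (h : B a x b) (k : B x y b) : B a x y :=
  (h.symm.shift k.symm).symm

lemma B.antisymm {a x y : X} (h : B a x y) (k : B a y x) : x = y := by
  unfold B at *
  rw [dist_comm y x] at k
  exact dist_le_zero.mp (by linarith)

lemma B.eq {a x : X} (h : B a x a) : x = a := by
  unfold B at h
  rw [dist_self, dist_comm a x] at h
  exact dist_le_zero.mp (by linarith)

/-- The median. -/
noncomputable def med (hm : IsMedianSpace X) (a b c : X) : X := (hm a b c).choose

lemma med_ab (hm : IsMedianSpace X) (a b c : X) : B a (med hm a b c) b := (hm a b c).choose_spec.1.1.1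
lemma med_bc (hm : IsMedianSpace X) (a b c : X) : B b (med hm a b c) c := (hm a b c).choose_spec.1.1.2
lemma med_ac (hm : IsMedianSpace X) (a b c : X) : B a (med hm a b c) c := (hm a b c).choose_spec.1.2
lemma med_unique (hm : IsMedianSpace X) {a b c z : X} (h1 : B a z b) (h2 : B b z c) (h3 : B a z c) :
    z = med hm a b c :=
  (hm a b c).choose_spec.2 z ⟨⟨h1, h2⟩, h3⟩

lemma med_eq_left (hm : IsMedianSpace X) {a b c : X} (h : B b a c) : med hm a b c = a :=
  (med_unique hm (B.left a b) h (B.left a c)).symm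

/-- Rectangle arising in an interval. -/
lemma rect_dist {a b u v s t : X} (hu : B a u b) (hv : B a v b)
    (s1 : B a s u) (s2 : B u s v) (s3 : B a s v)
    (t1 : B u t v) (t2 : B v t b) (t3 : B u t b) :
    dist s t = dist u v ∧ dist s u = dist t v ∧ dist s v = dist u t ∧
      dist a s + dist s t + dist t b = dist a b := by
  unfold B at *
  have h1 := dist_triangle4 a s t b
  have h2 := dist_triangle s u t
  have h3 := dist_triangle s v t
  have e1 := dist_comm s u
  have e2 := dist_comm v t
  refine ⟨?_, ?_, ?_, ?_⟩ <;> linarith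

lemma rect_incl (hm : IsMedianSpace X) {s t u v w : X} (hs : B u s v) (ht : B u t v) (hu : B s u t) (hv : B s v t)
    (hw : B u w v) : B s w t := by
  have a1 := med_ab hm u w s
  have a2 := med_bc hm u w s
  have a3 := med_ac hm u w s
  have b1 := med_ab hm v w s
  have b2 := med_bc hm v w s
  have b3 := med_ac hm v w s
  have c1 := med_ab hm u w t
  have c2 := med_bc hm u w t
  have c3 := med_ac hm u w t
  have d1 := med_ab hm v w t
  have d2 := med_bc hm v w t
  have d3 := med_ac hm v w t
  set m1 := med hm u w s
  set m2 := med hm v w s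
  set n1 := med hm u w t
  set n2 := med hm v w t
  -- key: a median of `s, t, w` on each side
  have key : ∀ {u m n : X}, B s u t → B u m w → B w m s → B u m s → B u n w → B w n t →
      B u n t → ∃ k, k = med hm s t w ∧ B u k w := by
    intro u m n hu a1 a2 a3 c1 c2 c3
    refine ⟨med hm m n w, ?_, ?_⟩
    · have k1 := med_ab hm m n w
      have k2 := med_bc hm m n w
      have k3 := med_ac hm m n w
      set k := med hm m n w
      have sk : B s k w := (a2.trans k3.symm).symm
      have tk : B t k w := (c2.trans k2.symm).symm
      refine med_unique hm ?_ tk sk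
      have mk : B u m k := a1.cut k3
      have nk : B u n k := c1.cut k2
      have msk : B s m k := a2.symm.cut k3
      have ntk : B t n k := c2.symm.cut k2
      have hu1 : B m u t := hu.shift a3.symm
      have hu2 : B m u n := hu1.cut c3
      unfold B at *
      have e1 := dist_comm s m
      have e2 := dist_comm u m
      have e3 := dist_comm u n
      have e4 := dist_comm n t
      have e5 := dist_comm k t
      have e6 := dist_comm k n
      have e7 := dist_comm s u
      linarith
    · exact (a1.symm.trans (med_ac hm m n w).symm).symm
  obtain ⟨k, hk, hk'⟩ := key hu a1 a2 a3 c1 c2 c3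
  obtain ⟨l, hl, hl'⟩ := key hv b1 b2 b3 d1 d2 d3
  have : w = k := by
    have e : l = k := by rw [hk, hl]
    subst e
    have h1 : B l w v := hw.shift hk'
    exact B.antisymm hl' h1.symm |>.symm
  rw [this, hk]
  exact med_ab hm s t w

/-- Intervals are convex. -/
lemma interval_convex (hm : IsMedianSpace X) {a b u v w : X} (hu : B a u b) (hv : B a v b)
    (hw : B u w v) : B a w b := by
  have s1 := med_ab hm a u v
  have s2 := med_bc hm a u v
  have s3 := med_ac hm a u v
  have t1 := med_ab hm u v b
  have t2 := med_bc hm u v b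
  have t3 := med_ac hm u v b
  set s := med hm a u v
  set t := med hm u v b
  obtain ⟨h1, h2, h3, h4⟩ := rect_dist hu hv s1 s2 s3 t1 t2 t3
  have hsut : B s u t := by
    unfold B at *
    linarith [dist_comm u s]
  have hsvt : B s v t := by
    unfold B at *
    linarith [dist_comm u s, dist_comm v t]
  have h := rect_incl hm s2 t1 hsut hsvt hw
  unfold B at *
  linarith [dist_triangle a w b, dist_triangle a s w, dist_triangle w t b]

/-- `med a b c` is the gate of `c` in `[a,b]`. -/
lemma gate (hm : IsMedianSpace X) {a b c z : X} (hz : B a z b) : B c (med hm a b c) z := by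
  have g1 := med_ab hm a b c
  have g2 := med_bc hm a b c
  have g3 := med_ac hm a b c
  have k1 := med_ab hm c z (med hm a b c)
  have k2 := med_bc hm c z (med hm a b c)
  have k3 := med_ac hm c z (med hm a b c)
  have : med hm c z (med hm a b c) = med hm a b c := by
    refine med_unique hm (interval_convex hm hz g1 k2) ?_ ?_
    · exact (g2.symm.trans k3).symm
    · exact (g3.symm.trans k3).symm
  rw [this] at k1
  exact k1

lemma shadow_convex (hm : IsMedianSpace X) {g c u v w : X} (hu : B u g c) (hv : B v g c)
    (hw : B u w v) : B w g c := by
  have e1 := med_ab hm g c w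
  have ew : B w (med hm g c w) g := gate hm (B.left g c)
  have ec : B w (med hm g c w) c := gate hm (B.right g c)
  set e := med hm g c w
  have hue : B u g e := hu.cut e1
  have hve : B v g e := hv.cut e1
  have s1 := med_ab hm u v g
  have s2 := med_bc hm u v g
  have s3 := med_ac hm u v g
  set s := med hm u v g
  have hst : s = med hm u v e := med_unique hm s1 (hve.trans s2) (hue.trans s3)
  have hsw : B e s w := by
    rw [hst]; exact gate hm hw
  have hg : B s g e := hue.shift s3
  have hgw : B e g w := hsw.trans hg.symm
  have : e = g := B.antisymm ew hgw.symm
  rwa [this] at ec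

/-- Gate maps preserve betweenness. -/
lemma med_between (hm : IsMedianSpace X) {p x u v w : X} (hw : B u w v) :
    B (med hm p x u) (med hm p x w) (med hm p x v) := by
  have hw' := med_ab hm p x w
  have hu' := med_ab hm p x u
  have hv' := med_ab hm p x v
  have gu : ∀ z, B p z x → B u (med hm p x u) z := fun z hz => gate hm hz
  have gv : ∀ z, B p z x → B v (med hm p x v) z := fun z hz => gate hm hz
  have gw : ∀ z, B p z x → B w (med hm p x w) z := fun z hz => gate hm hz
  set w' := med hm p x w
  set u' := med hm p x u
  set v' := med hm p x v
  have g1 := med_ab hm u' v' w'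
  have g2 := med_bc hm u' v' w'
  have g3 := med_ac hm u' v' w'
  set g := med hm u' v' w'
  have hg : B p g x := interval_convex hm hu' hv' g1
  have a1 : B u g w' := (gu w' hw').symm.trans g3.symm |>.symm
  have a2 : B v g w' := (gv w' hw').symm.trans g2.symm |>.symm
  have a3 : B w g w' := shadow_convex hm a1 a2 hw
  have : g = w' := B.antisymm a3 (gw g hg)
  rwa [this] at g1

/-- The interval `[p,x]` as a type. -/
def Seg (_hm : IsMedianSpace X) (p x : X) := {z : X // B p z x}

noncomputable instance segLattice (hm : IsMedianSpace X) (p x : X) : Lattice (Seg hm p x) where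
  le u v := B p u.1 v.1
  le_refl u := B.right _ _
  le_trans u v w h k := B.trans k h
  le_antisymm u v h k := Subtype.ext (B.antisymm h k)
  sup u v := ⟨med hm u.1 v.1 x, interval_convex hm u.2 v.2 (med_ab hm _ _ _)⟩
  inf u v := ⟨med hm u.1 v.1 p, interval_convex hm u.2 v.2 (med_ab hm _ _ _)⟩
  le_sup_left u v := u.2.cut (med_ac hm _ _ _)
  le_sup_right u v := v.2.cut (med_bc hm _ _ _)
  sup_le u v w h k := interval_convex hm h k (med_ab hm _ _ _)
  inf_le_left u v := (med_ac hm _ _ _).symm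
  inf_le_right u v := (med_bc hm _ _ _).symm
  le_inf u v w h k := by
    have h1 : B u.1 v.1 x := v.2.shift h
    have h2 : B u.1 w.1 x := w.2.shift k
    have h3 : B u.1 (med hm v.1 w.1 p) x := interval_convex hm h1 h2 (med_ab hm _ _ _)
    exact u.2.cut h3

lemma seg_le {hm : IsMedianSpace X} {p x : X} {u v : Seg hm p x} : u ≤ v ↔ B p u.1 v.1 := Iff.rfl

lemma between_le_sup {hm : IsMedianSpace X} {p x : X} {u v w : Seg hm p x}
    (h : B u.1 w.1 v.1) : w ≤ u ⊔ v :=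
  interval_convex hm (seg_le.1 (le_sup_left : u ≤ u ⊔ v)) (seg_le.1 (le_sup_right : v ≤ u ⊔ v)) h

lemma inf_le_between {hm : IsMedianSpace X} {p x : X} {u v w : Seg hm p x}
    (h : B u.1 w.1 v.1) : u ⊓ v ≤ w := by
  have h1 : B (u ⊓ v).1 u.1 x := u.2.shift (seg_le.1 (inf_le_left : u ⊓ v ≤ u))
  have h2 : B (u ⊓ v).1 v.1 x := v.2.shift (seg_le.1 (inf_le_right : u ⊓ v ≤ v))
  exact (u ⊓ v).2.cut (interval_convex hm h1 h2 h)

lemma inf_val {hm : IsMedianSpace X} {p x : X} (u v : Seg hm p x) :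
    (u ⊓ v).1 = med hm p u.1 v.1 :=
  med_unique hm (med_ac hm u.1 v.1 p).symm (med_ab hm u.1 v.1 p) (med_bc hm u.1 v.1 p).symm

noncomputable instance segDistrib (hm : IsMedianSpace X) (p x : X) :
    DistribLattice (Seg hm p x) :=
  DistribLattice.ofInfSupLe fun a b c => by
    apply between_le_sup
    rw [inf_val, inf_val, inf_val]
    exact med_between hm (med_ab hm b.1 c.1 x)

noncomputable instance segBot (hm : IsMedianSpace X) (p x : X) : OrderBot (Seg hm p x) where
  bot := ⟨p, B.left p x⟩
  bot_le u := seg_le.2 (B.left _ _)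

/-- Gate map to the segment. -/
noncomputable def proj (hm : IsMedianSpace X) (p x z : X) : Seg hm p x :=
  ⟨med hm p x z, med_ab hm p x z⟩

lemma proj_self {hm : IsMedianSpace X} {p x : X} (u : Seg hm p x) : proj hm p x u.1 = u :=
  Subtype.ext (med_unique hm u.2 (B.right _ _) (B.right _ _)).symm

/-- Separation by a halfspace of the ambient space. -/
lemma exists_halfspace {hm : IsMedianSpace X} {p x : X} {a b : Seg hm p x} (hab : ¬ a ≤ b) :
    ∃ h : Set X, IsHalfspace h ∧ (∀ u : Seg hm p x, a ≤ u → u.1 ∈ h) ∧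
      (∀ u : Seg hm p x, u ≤ b → u.1 ∉ h) := by
  obtain ⟨J, hJ, hbJ, hdis⟩ := DistribLattice.prime_ideal_of_disjoint_filter_ideal
    (F := Order.PFilter.principal a) (I := Order.Ideal.principal b) (by
      rw [Set.disjoint_left]
      intro u hu hu'
      exact hab (le_trans (Order.PFilter.mem_principal.1 hu) (Order.Ideal.mem_principal.1 hu')))
  refine ⟨{z | proj hm p x z ∉ J}, ⟨?_, ?_⟩, ?_, ?_⟩
  · intro u hu v hv w hw hwJ
    have h1 : proj hm p x u ⊓ proj hm p x v ≤ proj hm p x w :=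
      inf_le_between (med_between hm hw)
    rcases hJ.mem_or_mem (J.lower h1 hwJ) with h | h
    · exact hu h
    · exact hv h
  · intro u hu v hv w hw hwJ
    have h1 : proj hm p x w ≤ proj hm p x u ⊔ proj hm p x v :=
      between_le_sup (med_between hm hw)
    exact hwJ (J.lower h1 (Order.Ideal.sup_mem (not_not.1 hu) (not_not.1 hv)))
  · intro u hu
    simp only [Set.mem_ofPred_eq, proj_self]
    exact Set.disjoint_left.1 hdis (Order.PFilter.mem_principal.2 hu)
  · intro u hu h
    rw [Set.mem_ofPred_eq, proj_self] at h
    exact h (hbJ (Order.Ideal.mem_principal.2 hu))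

lemma dist_sup_le {hm : IsMedianSpace X} {p x : X} (u v : Seg hm p x) :
    dist p (u ⊔ v).1 ≤ dist p u.1 + dist p v.1 := by
  obtain ⟨h1, h2, h3, h4⟩ := rect_dist u.2 v.2 (med_ab hm p u.1 v.1) (med_bc hm p u.1 v.1)
    (med_ac hm p u.1 v.1) (med_ab hm u.1 v.1 x) (med_bc hm u.1 v.1 x) (med_ac hm u.1 v.1 x)
  have h5 := med_ac hm p u.1 v.1
  unfold B at h5
  have h6 : (u ⊔ v).1 = med hm u.1 v.1 x := rfl
  rw [h6]
  linarith [dist_triangle p u.1 (med hm u.1 v.1 x),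
    dist_nonneg (x := p) (y := med hm p u.1 v.1)]

lemma dist_finset_sup_le {hm : IsMedianSpace X} {p x : X} (S : Finset (Seg hm p x)) {r : ℝ}
    (hS : ∀ a ∈ S, dist p a.1 ≤ r) : dist p (S.sup id).1 ≤ S.card * r := by
  classical
  induction S using Finset.induction_on with
  | empty =>
    have : (Finset.sup (∅ : Finset (Seg hm p x)) id).1 = p := rfl
    rw [this]; simp
  | insert a S ha ih =>
    rw [Finset.sup_insert, Finset.card_insert_of_notMem ha]
    have h1 := ih (fun b hb => hS b (Finset.mem_insert_of_mem hb))
    have h2 := hS a (Finset.mem_insert_self a S)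
    have h3 := dist_sup_le (id a) (S.sup id)
    push_cast
    simp only [id] at h3 h1 ⊢
    linarith

/-- A minimal cover of the top has at most `n` elements. -/
lemma dist_le_of_cover {hm : IsMedianSpace X} {p x : X} {n : ℕ} (hrank : HasMedianRank X n)
    {r : ℝ} (hr : 0 ≤ r) (S : Finset (Seg hm p x)) (hS : ∀ a ∈ S, dist p a.1 ≤ r)
    (hx : (S.sup id).1 = x) : dist p x ≤ n * r := by
  classical
  induction hk : S.card using Nat.strong_induction_on generalizing S with
  | _ k ih =>
  by_cases hred : ∃ a ∈ S, a ≤ (S.erase a).sup id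
  · obtain ⟨a, ha, hle⟩ := hred
    refine ih (S.erase a).card ?_ (S.erase a) (fun b hb => hS b (Finset.mem_of_mem_erase hb)) ?_ rfl
    · rw [← hk]; exact Finset.card_erase_lt_of_mem ha
    · have e : S.sup id = (S.erase a).sup id := by
        conv_lhs => rw [← Finset.insert_erase ha, Finset.sup_insert]
        exact sup_eq_right.2 hle
      exact (congrArg Subtype.val e).symm.trans hx
  · push Not at hred
    have hcard : S.card ≤ n := by
      by_contra hlt
      push Not at hlt
      apply hrank.2
      choose H hH1 hH2 hH3 using fun a : S => exists_halfspace (hred a.1 a.2)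
      obtain ⟨f⟩ : Nonempty (Fin (n + 1) ↪ S) := by
        apply Function.Embedding.nonempty_of_card_le
        simpa using hlt
      have hin : ∀ i j, i ≠ j → (f i).1.1 ∉ H (f j) := by
        intro i j hij
        apply hH3
        have hne : (f i).1 ≠ (f j).1 := fun h => hij (f.injective (Subtype.ext h))
        exact Finset.le_sup (f := id) (Finset.mem_erase.2 ⟨hne, (f i).2⟩)
      have hself : ∀ i, (f i).1.1 ∈ H (f i) := fun i => hH2 _ _ le_rfl
      have htop : ∀ i, (S.sup id).1 ∈ H (f i) := fun i =>
        hH2 _ _ (Finset.le_sup (f := id) (f i).2)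
      have hbot : ∀ i, (⊥ : Seg hm p x).1 ∉ H (f i) := fun i => hH3 _ _ bot_le
      refine ⟨fun i => H (f i), fun i => hH1 _, fun i j hij => ⟨⟨_, htop i, htop j⟩,
        ⟨_, hin j i hij.symm, hself j⟩, ⟨_, hself i, hin i j hij⟩, ⟨_, hbot i, hbot j⟩⟩⟩
    have h := dist_finset_sup_le S hS
    rw [hx] at h
    have : (S.card : ℝ) ≤ n := by exact_mod_cast hcard
    exact h.trans (mul_le_mul_of_nonneg_right this hr)

/-- Existence of gates in closed convex sets. -/
lemma exists_gate [CompleteSpace X] (hm : IsMedianSpace X) {C : Set X} (hne : C.Nonempty)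
    (hcl : IsClosed C) (hconv : MConvex C) (x : X) :
    ∃ p ∈ C, dist x p = Metric.infDist x C ∧ ∀ c ∈ C, B x p c := by
  have hle : ∀ c ∈ C, Metric.infDist x C ≤ dist x c := fun c hc => Metric.infDist_le_dist_of_mem hc
  have hseq : ∀ k : ℕ, ∃ c ∈ C, dist x c < Metric.infDist x C + 1 / ((k : ℝ) + 1) := fun k =>
    (Metric.infDist_lt_iff hne).1 (by linarith [Nat.one_div_pos_of_nat (α := ℝ) (n := k)])
  choose c hcC hc using hseq
  have hdist : ∀ u ∈ C, ∀ v ∈ C, dist u v ≤ dist x u + dist x v - 2 * Metric.infDist x C := by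
    intro u hu v hv
    have h1 := med_ab hm u v x
    have h2 := med_bc hm u v x
    have h3 := med_ac hm u v x
    have h4 := hle _ (hconv u hu v hv h1)
    unfold B at *
    linarith [dist_comm (med hm u v x) v, dist_comm (med hm u v x) x, dist_comm u x,
      dist_comm v x]
  have hlim := tendsto_one_div_add_atTop_nhds_zero_nat (𝕜 := ℝ)
  have hcau : CauchySeq c := by
    refine cauchySeq_of_le_tendsto_0 (fun k : ℕ => 2 * (1 / ((k : ℝ) + 1))) ?_ ?_
    · intro i j N hi hj
      have h1 := hdist _ (hcC i) _ (hcC j)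
      have h2 := Nat.one_div_le_one_div (α := ℝ) hi
      have h3 := Nat.one_div_le_one_div (α := ℝ) hj
      linarith [hc i, hc j]
    · simpa using hlim.const_mul 2
  obtain ⟨p, hp⟩ := cauchySeq_tendsto_of_complete hcau
  have hpC : p ∈ C := hcl.mem_of_tendsto hp (Filter.Eventually.of_forall hcC)
  have hpd : dist x p = Metric.infDist x C := by
    refine le_antisymm ?_ (hle p hpC)
    have h1 : Filter.Tendsto (fun k => dist x (c k)) Filter.atTop (nhds (dist x p)) :=
      tendsto_const_nhds.dist hp
    have h2 : Filter.Tendsto (fun k : ℕ => Metric.infDist x C + 1 / ((k : ℝ) + 1)) Filter.atTop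
        (nhds (Metric.infDist x C)) := by simpa using hlim.const_add (Metric.infDist x C)
    exact le_of_tendsto_of_tendsto' h1 h2 fun k => (hc k).le
  refine ⟨p, hpC, hpd, fun c hcC => ?_⟩
  have h1 := hdist p hpC c hcC
  unfold B
  linarith [dist_triangle x p c]

lemma dist_proj_le {hm : IsMedianSpace X} {p x y c : X} (hc : B x p c) :
    dist p (proj hm p x y).1 ≤ dist y c := by
  have h1 : B y (proj hm p x y).1 p := gate hm (B.left p x)
  have h2 : B (proj hm p x y).1 p c := hc.shift (proj hm p x y).2.symm
  unfold B at *
  linarith [dist_triangle y c p, dist_triangle (proj hm p x y).1 y c,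
    dist_comm (proj hm p x y).1 p, dist_comm (proj hm p x y).1 y, dist_comm p c]

end MedAux

/-- In a complete median space of rank `n`, the convex hull of the closed `r`-tubular
neighbourhood of a nonempty closed convex set `C` is contained in the `n·r`-tubular
neighbourhood of `C`. -/
theorem statement5 (X : Type*) [MetricSpace X] [CompleteSpace X]
    (hmed : IsMedianSpace X) (n : ℕ) (hrank : HasMedianRank X n)
    (C : Set X) (hCne : C.Nonempty) (hCcl : IsClosed C) (hCconv : MConvex C)
    (r : ℝ) (hr : 0 < r) :
    mConvexHull {x : X | Metric.infDist x C ≤ r} ⊆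
      {x : X | Metric.infDist x C ≤ n * r} := by
  classical
  intro x hx
  obtain ⟨p, hpC, hpd, hpg⟩ := MedAux.exists_gate hmed hCne hCcl hCconv x
  have hx' : x ∈ {z : X | ∃ S : Finset (MedAux.Seg hmed p x), (∀ a ∈ S, dist p a.1 ≤ r) ∧
      MedAux.proj hmed p x z ≤ S.sup id} := by
    refine hx _ ⟨?_, ?_⟩
    · rintro u ⟨S, hS, hu⟩ v ⟨T, hT, hv⟩ w hw
      refine ⟨S ∪ T, ?_, ?_⟩
      · intro a ha
        rcases Finset.mem_union.1 ha with h | h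
        · exact hS a h
        · exact hT a h
      · rw [Finset.sup_union]
        exact le_trans (MedAux.between_le_sup (MedAux.med_between hmed hw)) (sup_le_sup hu hv)
    · intro y hy
      obtain ⟨c, hcC, hcd, -⟩ := MedAux.exists_gate hmed hCne hCcl hCconv y
      refine ⟨{MedAux.proj hmed p x y}, ?_, by simp⟩
      intro a ha
      rw [Finset.mem_singleton.1 ha]
      refine le_trans (MedAux.dist_proj_le (hpg c hcC)) ?_
      rw [hcd]
      exact hy
  obtain ⟨S, hS, hle⟩ := hx'
  have htop : (S.sup id).1 = x := by
    have h1 : MedAux.B p (MedAux.proj hmed p x x).1 (S.sup id).1 := hle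
    have h2 : MedAux.proj hmed p x x = ⟨x, MedAux.B.right p x⟩ :=
      MedAux.proj_self (⟨x, MedAux.B.right p x⟩ : MedAux.Seg hmed p x)
    rw [h2] at h1
    exact MedAux.B.antisymm (S.sup id).2 h1
  have h := MedAux.dist_le_of_cover hrank hr.le S hS htop
  show Metric.infDist x C ≤ n * r
  rw [← hpd, dist_comm]
  exact h
end

section
/- Let X be a complete median space of finite rank and let C₁, C₂ be closed convex subsets of X whose intersection is a single point x₀. Then for every x ∈ Conv(C₁ ∪ C₂), the interval [x, x₀] is isometric to the ℓ¹-product [π_{C₁}(x), x₀] × [π_{C₂}(x), x₀] (with metric the sum of the two distances). -/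
/-- Betweenness: `y` lies on the interval `[a,b]`. -/
def Bt {X : Type*} [MetricSpace X] (a y b : X) : Prop := dist a y + dist y b = dist a b

namespace Bt
variable {X : Type*} [MetricSpace X]

theorem symm {a y b : X} (h : Bt a y b) : Bt b y a := by
  unfold Bt at *
  rw [dist_comm b y, dist_comm y a, dist_comm b a]; linarith

/-- order `a z y b` -/
theorem sub {a z y b : X} (h : Bt a y b) (h' : Bt a z y) : Bt a z b := by
  unfold Bt at *
  linarith [dist_triangle a z b, dist_triangle z y b]

/-- order `a z y b` -/
theorem sub' {a z y b : X} (h : Bt a y b) (h' : Bt a z y) : Bt z y b := by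
  unfold Bt at *
  linarith [dist_triangle a z b, dist_triangle z y b]

theorem right (a b : X) : Bt a b b := by simp [Bt]
theorem left (a b : X) : Bt a a b := by simp [Bt]

theorem collapse {p q r y : X} (h1 : Bt y r p) (h2 : Bt y r q) (h : Bt p y q) : r = y := by
  unfold Bt at *
  have : dist y r ≤ 0 := by
    linarith [dist_triangle p r q, dist_comm p y, dist_comm r p]
  exact (dist_le_zero.1 this).symm

theorem anti {a b c : X} (h1 : Bt a b c) (h2 : Bt a c b) : b = c := by
  unfold Bt at *
  have : dist b c ≤ 0 := by linarith [dist_comm b c]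
  exact dist_le_zero.1 this

/-- opposite sides of a rectangle `a b c d` -/
theorem rect {a b c d : X} (h1 : Bt a b c) (h2 : Bt a d c) (h3 : Bt b a d) (h4 : Bt b c d) :
    dist a b = dist d c := by
  unfold Bt at *
  linarith [dist_comm a b, dist_comm c d]

end Bt

section
variable {X : Type*} [MetricSpace X]

theorem med_ex (hm : IsMedianSpace X) (a b c : X) : ∃ m, Bt a m b ∧ Bt b m c ∧ Bt a m c := by
  obtain ⟨m, ⟨⟨h1, h2⟩, h3⟩, _⟩ := hm a b c
  exact ⟨m, h1, h2, h3⟩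

theorem med_uniq (hm : IsMedianSpace X) {a b c m m' : X} (h1 : Bt a m b) (h2 : Bt b m c)
    (h3 : Bt a m c) (h1' : Bt a m' b) (h2' : Bt b m' c) (h3' : Bt a m' c) : m = m' :=
  (hm a b c).unique ⟨⟨h1, h2⟩, h3⟩ ⟨⟨h1', h2'⟩, h3'⟩

/-- The median is the gate of `c` on `[a,b]`. -/
theorem gate (hm : IsMedianSpace X) {a b c p y : X} (h1 : Bt a p b) (h2 : Bt b p c)
    (h3 : Bt a p c) (hy : Bt a y b) : Bt c p y := by
  obtain ⟨u, u1, u2, u3⟩ := med_ex hm a y c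
  obtain ⟨v, v1, v2, v3⟩ := med_ex hm b y c
  obtain ⟨w, w1, w2, w3⟩ := med_ex hm u v c
  have hub : Bt u y b := hy.sub' u1
  have huv : Bt u v b := (hub.symm.sub v1).symm
  have huvy : Bt u y v := (hub.symm.sub' v1).symm
  have hav : Bt a v b := (hy.symm.sub v1).symm
  have hau : Bt a u b := hy.sub u1
  have hwb : Bt u w b := huv.sub w1
  have hawb : Bt a w b := (hau.symm.sub hwb.symm).symm
  have hawc : Bt a w c := (u3.symm.sub w3.symm).symm
  have hbwc : Bt b w c := (v3.symm.sub w2.symm).symm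
  have e : p = w := med_uniq hm h1 h2 h3 hawb hbwc hawc
  subst e
  exact u2.symm.sub w3.symm

theorem int_conv (hm : IsMedianSpace X) {a b y z w : X} (hy : Bt a y b) (hz : Bt a z b)
    (hw : Bt y w z) : Bt a w b := by
  obtain ⟨p, p1, p2, p3⟩ := med_ex hm a b w
  have := Bt.collapse (gate hm p1 p2 p3 hy) (gate hm p1 p2 p3 hz) hw
  rwa [this] at p1

/-- shadows are convex -/
theorem shadow (hm : IsMedianSpace X) {r w z1 z2 z : X} (h1 : Bt w r z1) (h2 : Bt w r z2)
    (hz : Bt z1 z z2) : Bt w r z := by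
  obtain ⟨s, s1, s2, s3⟩ := med_ex hm z1 z2 r
  have a1 : Bt z1 s w := h1.symm.sub s3
  have a2 : Bt z2 s w := h2.symm.sub s2
  have g := gate hm s1 a2 a1 hz
  exact g.sub (h1.symm.sub' s3).symm

/-- gate property of nearest-point projections -/
theorem proj_gate (hm : IsMedianSpace X) {C : Set X} (hC : MConvex C) {π : X → X}
    (hπ : IsNearestPointProj C π) (x c : X) (hc : c ∈ C) : Bt x (π x) c := by
  obtain ⟨m, m1, m2, m3⟩ := med_ex hm x (π x) c
  have hmC : m ∈ C := hC _ (hπ x).1 _ hc m2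
  have h := Metric.infDist_le_dist_of_mem (x := x) hmC
  rw [← (hπ x).2] at h
  have e : m = π x := by
    unfold Bt at m1
    exact dist_le_zero.1 (by linarith)
  rwa [e] at m3

/-- The complementary corners `p1 p2` of the interval `[x,o]`. -/
structure Corner (x o p1 p2 : X) : Prop where
  a : Bt x p1 o
  b : Bt x p2 o
  c : Bt p1 x p2
  d : Bt p1 o p2

theorem Corner.swap {x o p1 p2 : X} (h : Corner x o p1 p2) : Corner x o p2 p1 :=
  ⟨h.b, h.a, h.c.symm, h.d.symm⟩

/-- `y1` is the median of `y, p, o`. -/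
structure Med (p o y y1 : X) : Prop where
  a : Bt p y1 o
  b : Bt y y1 o
  c : Bt y y1 p

theorem Med.gate (hm : IsMedianSpace X) {p o y y1 z : X} (h : Med p o y y1) (hz : Bt p z o) :
    Bt y y1 z := _root_.gate hm h.a h.b.symm h.c.symm hz

theorem Med.uniq (hm : IsMedianSpace X) {p o y y1 y2 : X} (h : Med p o y y1) (h' : Med p o y y2) :
    y1 = y2 := med_uniq hm h.a h.b.symm h.c.symm h'.a h'.b.symm h'.c.symm

theorem med_ex' (hm : IsMedianSpace X) (p o y : X) : ∃ y1, Med p o y y1 := by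
  obtain ⟨m, h1, h2, h3⟩ := med_ex hm p o y
  exact ⟨m, h1, h2.symm, h3.symm⟩

/-- each point of `[x,o]` is the corner of a rectangle -/
theorem corner_sub (hm : IsMedianSpace X) {x o p1 p2 y y1 y2 : X} (h : Corner x o p1 p2)
    (hy : Bt x y o) (h1 : Med p1 o y y1) (h2 : Med p2 o y y2) : Corner y o y1 y2 := by
  have hyp : Bt p1 y p2 := int_conv hm h.c h.d hy
  refine ⟨h1.b, h2.b, ?_, ?_⟩
  · obtain ⟨r, r1, r2, r3⟩ := med_ex hm y y1 y2
    have e : r = y := Bt.collapse (h1.c.sub r1) (h2.c.sub r3) hyp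
    rwa [e] at r2
  · have a1 : Bt y1 o p2 := h.d.sub' h1.a
    exact (a1.symm.sub' h2.a).symm

theorem norm_add {o y y1 y2 : X} (h : Corner y o y1 y2) :
    dist y o = dist y1 o + dist y2 o := by
  have := Bt.rect h.a h.b h.c.symm.symm h.d
  have := h.a
  unfold Bt at this
  linarith

theorem surj_aux (hm : IsMedianSpace X) {x o p1 p2 u v y : X} (h : Corner x o p1 p2)
    (hu : Bt p1 u o) (hv : Bt p2 v o) (y1 : Bt x y u) (y3 : Bt u y v) :
    Med p1 o y u := by
  obtain ⟨g, hg⟩ := med_ex' hm p1 o y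
  have g1 : Bt y g u := hg.gate hm hu
  have hgo2 : Bt g o p2 := h.d.sub' hg.a
  have hgov : Bt g o v := (hgo2.symm.sub' hv).symm
  have g2 : Bt u g v := y3.sub g1.symm
  have g3 : Bt u g o := by
    have t := g2.symm.sub' hgov.symm
    exact t.symm
  have g4 : Bt x g u := (y1.symm.sub g1.symm).symm
  have hx : Med p1 o x p1 := ⟨Bt.left _ _, h.a, Bt.right _ _⟩
  have g5 : Bt x p1 g := hx.gate hm hg.a
  have g6 : Bt p1 g u := g4.sub' g5
  have e : g = u := Bt.collapse g6.symm g3 hu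
  rwa [e] at hg

theorem surj (hm : IsMedianSpace X) {x o p1 p2 u v : X} (h : Corner x o p1 p2)
    (hu : Bt p1 u o) (hv : Bt p2 v o) : ∃ y, Bt x y o ∧ Med p1 o y u ∧ Med p2 o y v := by
  obtain ⟨y, y1, y2, y3⟩ := med_ex hm x u v
  refine ⟨y, ?_, surj_aux hm h hu hv y1 y2, surj_aux hm h.swap hv hu y3 y2.symm⟩
  exact int_conv hm (h.a.symm.sub hu.symm).symm (h.b.symm.sub hv.symm).symm y2

theorem side_aux (hm : IsMedianSpace X) {o y w y1 y2 w2 : X}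
    (hy : Corner y o y1 y2) (hw : Corner w o y1 w2) : Bt y2 y w := by
  obtain ⟨r, r1, r2, r3⟩ := med_ex hm y y2 w
  have d1 : Bt y r o := hy.b.sub r1
  have d2 : Bt y r y1 := shadow hm r3 d1 hw.a
  have e : r = y := Bt.collapse d2 r1 hy.c
  rwa [e] at r2

theorem side (hm : IsMedianSpace X) {x o p1 p2 y w y1 y2 w2 : X} (h : Corner x o p1 p2)
    (hy : Bt x y o) (hw : Bt x w o)
    (h1 : Med p1 o y y1) (h2 : Med p2 o y y2) (k1 : Med p1 o w y1) (k2 : Med p2 o w w2) :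
    dist y w = dist y2 w2 := by
  have cy := corner_sub hm h hy h1 h2
  have cw := corner_sub hm h hw k1 k2
  exact Bt.rect (side_aux hm cw cy).symm (h2.gate hm k2.a)
    (side_aux hm cy cw).symm (k2.gate hm h2.a)

theorem mono_aux (hm : IsMedianSpace X) {o p y k y1 k1 : X} (hk : Bt y k o)
    (h1 : Med p o y y1) (k1' : Med p o k k1) : Bt y1 k1 o := by
  have a : Bt y k1 o := (hk.symm.sub k1'.b.symm).symm
  exact a.sub' (h1.gate hm k1'.a)

theorem dist_eq (hm : IsMedianSpace X) {x o p1 p2 y z y1 y2 z1 z2 : X} (h : Corner x o p1 p2)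
    (hy : Bt x y o) (hz : Bt x z o)
    (h1 : Med p1 o y y1) (h2 : Med p2 o y y2) (k1 : Med p1 o z z1) (k2 : Med p2 o z z2) :
    dist y z = dist y1 z1 + dist y2 z2 := by
  apply le_antisymm
  · obtain ⟨w, w0, w1, w2⟩ := surj hm h h1.a k2.a
    have a := side hm h hy w0 h1 h2 w1 w2
    have b := side hm h.swap w0 hz w2 w1 k2 k1
    linarith [dist_triangle y w z]
  · obtain ⟨k, a1, a2, a3⟩ := med_ex hm y z o
    obtain ⟨l1, m1⟩ := med_ex' hm p1 o k
    obtain ⟨l2, m2⟩ := med_ex' hm p2 o k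
    have hk : Bt x k o := (hy.symm.sub a3.symm).symm
    have n1 := norm_add (corner_sub hm h hy h1 h2)
    have n2 := norm_add (corner_sub hm h hz k1 k2)
    have n3 := norm_add (corner_sub hm h hk m1 m2)
    have b1 := mono_aux hm a3 h1 m1
    have b2 := mono_aux hm a3 h2 m2
    have b3 := mono_aux hm a2 k1 m1
    have b4 := mono_aux hm a2 k2 m2
    unfold Bt at a1 a2 a3 b1 b2 b3 b4
    linarith [dist_triangle y1 l1 z1, dist_triangle y2 l2 z2, dist_comm z1 l1, dist_comm z2 l2,
      dist_comm z k]

end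

/-- If closed convex sets `C₁`, `C₂` meet in a single point `x₀`, then for every
`x ∈ Conv(C₁ ∪ C₂)` the interval `[x,x₀]` is isometric to the `ℓ¹`-product
`[π_{C₁}(x), x₀] × [π_{C₂}(x), x₀]`. -/
theorem statement8 (X : Type*) [MetricSpace X] [CompleteSpace X]
    (hmed : IsMedianSpace X) (hrank : ∃ n : ℕ, HasMedianRank X n)
    (C₁ C₂ : Set X) (h₁cl : IsClosed C₁) (h₂cl : IsClosed C₂)
    (h₁cv : MConvex C₁) (h₂cv : MConvex C₂)
    (x₀ : X) (hint : C₁ ∩ C₂ = {x₀})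
    (π₁ π₂ : X → X) (hπ₁ : IsNearestPointProj C₁ π₁) (hπ₂ : IsNearestPointProj C₂ π₂)
    (x : X) (hx : x ∈ mConvexHull (C₁ ∪ C₂)) :
    Nonempty ((mInterval x x₀) ≃ᵢ
      WithLp 1 ((mInterval (π₁ x) x₀) × (mInterval (π₂ x) x₀))) := by
  have hx₀ : x₀ ∈ C₁ ∩ C₂ := by rw [hint]; rfl
  have g1 := proj_gate hmed h₁cv hπ₁ x
  have g2 := proj_gate hmed h₂cv hπ₂ x
  have hc : Corner x x₀ (π₁ x) (π₂ x) := by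
    refine ⟨g1 _ hx₀.1, g2 _ hx₀.2, ?_, ?_⟩
    · obtain ⟨r, r1, r2, r3⟩ := med_ex hmed x (π₁ x) (π₂ x)
      have hD : x ∈ {z : X | Bt x r z} := by
        refine hx _ ⟨fun a ha b hb z hz => shadow hmed ha hb hz, ?_⟩
        rintro c (hc | hc)
        · exact (g1 c hc).sub r1
        · exact (g2 c hc).sub r3
      have e : r = x := Bt.collapse hD hD (Bt.left x x)
      rwa [e] at r2
    · obtain ⟨r, r1, r2, r3⟩ := med_ex hmed (π₁ x) (π₂ x) x₀
      have hr : r ∈ C₁ ∩ C₂ := ⟨h₁cv _ (hπ₁ x).1 _ hx₀.1 r3, h₂cv _ (hπ₂ x).1 _ hx₀.2 r2⟩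
      rw [hint] at hr
      have e : r = x₀ := hr
      rwa [e] at r1
  choose f hf using med_ex' hmed (π₁ x) x₀
  choose g hg using med_ex' hmed (π₂ x) x₀
  let F : (mInterval x x₀) → WithLp 1 ((mInterval (π₁ x) x₀) × (mInterval (π₂ x) x₀)) :=
    fun y => WithLp.toLp 1 (⟨f y, (hf y).a⟩, ⟨g y, (hg y).a⟩)
  have hF : Isometry F := by
    refine Isometry.of_dist_eq fun y z => ?_
    rw [WithLp.prod_dist_eq_add (by norm_num)]
    have := dist_eq hmed hc y.2 z.2 (hf y) (hg y) (hf z) (hg z)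
    simp [F, Subtype.dist_eq, this]
  have hS : Function.Surjective F := by
    intro q
    obtain ⟨y, y0, y1, y2⟩ := surj hmed hc q.fst.2 q.snd.2
    refine ⟨⟨y, y0⟩, ?_⟩
    have e1 := (hf y).uniq hmed y1
    have e2 := (hg y).uniq hmed y2
    apply WithLp.ofLp_injective
    exact Prod.ext (Subtype.ext e1) (Subtype.ext e2)
  exact ⟨⟨Equiv.ofBijective F ⟨hF.injective, hS⟩, hF⟩⟩
end

section
/- Let X be a nonempty complete connected median space of rank n (with n ≥ 1) such that the isometry group of X acts transitively on X. If there exists a point x ∈ X such that the set H_x of halfspaces branched at x contains three pairwise disjoint halfspaces, then X is not locally compact. -/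
namespace MedSp

open Set Filter Topology

section Found
variable {X : Type*} [MetricSpace X]

lemma memI {a b x : X} : x ∈ mInterval a b ↔ dist a x + dist x b = dist a b := Iff.rfl

lemma I_symm {a b x : X} (h : x ∈ mInterval a b) : x ∈ mInterval b a := by
  rw [memI] at *
  rw [dist_comm b x, dist_comm x a, dist_comm b a]; linarith

lemma I_left (a b : X) : a ∈ mInterval a b := by simp [memI]

lemma I_right (a b : X) : b ∈ mInterval a b := by simp [memI]

lemma I_self {a x : X} (h : x ∈ mInterval a a) : x = a := by
  rw [memI, dist_self, dist_comm x a] at h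
  have : dist a x = 0 := by linarith [dist_nonneg (x := a) (y := x)]
  exact (dist_eq_zero.1 this).symm

/-- `a - w - x - b` -/
lemma I_trans {a b x w : X} (hx : x ∈ mInterval a b) (hw : w ∈ mInterval a x) :
    w ∈ mInterval a b := by
  rw [memI] at *
  have h1 := dist_triangle w x b
  have h2 := dist_triangle a w b
  linarith

lemma I_trans' {a b x w : X} (hx : x ∈ mInterval a b) (hw : w ∈ mInterval a x) :
    x ∈ mInterval w b := by
  rw [memI] at *
  have h1 := dist_triangle w x b
  have h2 := dist_triangle a w b
  linarith

/-- the median -/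
noncomputable def med (hm : IsMedianSpace X) (a b c : X) : X := (hm a b c).choose


lemma med_ab (hm : IsMedianSpace X) (a b c : X) : med hm a b c ∈ mInterval a b := (hm a b c).choose_spec.1.1.1
lemma med_bc (hm : IsMedianSpace X) (a b c : X) : med hm a b c ∈ mInterval b c := (hm a b c).choose_spec.1.1.2
lemma med_ac (hm : IsMedianSpace X) (a b c : X) : med hm a b c ∈ mInterval a c := (hm a b c).choose_spec.1.2

lemma med_uniq (hm : IsMedianSpace X) {a b c x : X} (h1 : x ∈ mInterval a b) (h2 : x ∈ mInterval b c)
    (h3 : x ∈ mInterval a c) : x = med hm a b c :=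
  (hm a b c).choose_spec.2 x ⟨⟨h1, h2⟩, h3⟩

/-- gate property of intervals -/
lemma gate (hm : IsMedianSpace X) {a b c x : X} (hc : c ∈ mInterval a b) : med hm a b x ∈ mInterval x c := by
  set u := med hm x a c with hu
  set v := med hm x b c with hv
  set w := med hm x u v with hw
  have hxu : u ∈ mInterval x a := med_ab hm _ _ _
  have hac : u ∈ mInterval a c := med_bc hm _ _ _
  have hxc : u ∈ mInterval x c := med_ac hm _ _ _
  have vxb : v ∈ mInterval x b := med_ab hm _ _ _
  have vbc : v ∈ mInterval b c := med_bc hm _ _ _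
  have wxu : w ∈ mInterval x u := med_ab hm _ _ _
  have wuv : w ∈ mInterval u v := med_bc hm _ _ _
  have wxv : w ∈ mInterval x v := med_ac hm _ _ _
  have wab : w ∈ mInterval a b := by
    rw [memI] at *
    have t1 := dist_triangle a w b
    have t2 := dist_triangle a u w
    have t3 := dist_triangle w v b
    have t4 := dist_triangle u c v
    rw [dist_comm b v, dist_comm v c, dist_comm b c] at vbc
    linarith
  have e : w = med hm a b x :=
    med_uniq hm wab (I_symm (I_trans vxb wxv)) (I_symm (I_trans hxu wxu))
  rw [← e]
  exact I_trans hxc wxu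

lemma I_convex (hm : IsMedianSpace X) (a b : X) : MConvex (mInterval a b) := by
  intro c hc d hd z hz
  have h1 := gate hm (x := z) hc
  have h2 := gate hm (x := z) hd
  have h3 := med_ab hm a b z
  set m := med hm a b z
  have : dist z m = 0 := by
    rw [memI] at h1 h2 hz
    have t := dist_triangle c m d
    rw [dist_comm c z] at hz
    rw [dist_comm c m] at t
    linarith [dist_nonneg (x := z) (y := m)]
  rw [dist_eq_zero.1 this]; exact h3

lemma med_lip (hm : IsMedianSpace X) (a b x y : X) : dist (med hm a b x) (med hm a b y) ≤ dist x y := by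
  have h1 := gate hm (x := x) (med_ab hm a b y)
  have h2 := gate hm (x := y) (med_ab hm a b x)
  rw [memI] at h1 h2
  have t1 := dist_triangle x y (med hm a b y)
  have t2 := dist_triangle y x (med hm a b x)
  rw [dist_comm (med hm a b y) (med hm a b x)] at h2
  rw [dist_comm y x] at t2
  linarith

lemma med_rot (hm : IsMedianSpace X) (a b c : X) : med hm a b c = med hm b c a :=
  med_uniq hm (med_bc hm a b c) (I_symm (med_ac hm a b c)) (I_symm (med_ab hm a b c))

lemma med_swap (hm : IsMedianSpace X) (a b c : X) : med hm a b c = med hm b a c :=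
  med_uniq hm (I_symm (med_ab hm a b c)) (med_ac hm a b c) (med_bc hm a b c)

lemma med_eq_of_mem (hm : IsMedianSpace X) {a b x : X} (h : x ∈ mInterval a b) : med hm a b x = x :=
  (med_uniq hm h (I_right _ _) (I_right _ _)).symm

lemma med_cont (hm : IsMedianSpace X) : Continuous (fun q : X × X × X => med hm q.1 q.2.1 q.2.2) := by
  have key : LipschitzWith 3 (fun q : X × X × X => med hm q.1 q.2.1 q.2.2) := by
    refine LipschitzWith.of_dist_le_mul ?_
    rintro ⟨a, b, c⟩ ⟨a', b', c'⟩
    have h1 : dist (med hm a b c) (med hm a b c') ≤ dist c c' := med_lip hm _ _ _ _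
    have h2 : dist (med hm a b c') (med hm a b' c') ≤ dist b b' := by
      have := med_lip hm c' a b b'
      rwa [med_rot hm c' a b, med_rot hm c' a b'] at this
    have h3 : dist (med hm a b' c') (med hm a' b' c') ≤ dist a a' := by
      have := med_lip hm b' c' a a'
      rwa [← med_rot hm a b' c', ← med_rot hm a' b' c'] at this
    have t1 := dist_triangle (med hm a b c) (med hm a b c') (med hm a' b' c')
    have t2 := dist_triangle (med hm a b c') (med hm a b' c') (med hm a' b' c')
    have m1 : dist a a' ≤ dist (a, b, c) (a', b', c') := by
      rw [Prod.dist_eq]; exact le_max_left _ _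
    have m2 : dist b b' ≤ dist (a, b, c) (a', b', c') := by
      rw [Prod.dist_eq, Prod.dist_eq]; exact (le_max_left _ _).trans (le_max_right _ _)
    have m3 : dist c c' ≤ dist (a, b, c) (a', b', c') := by
      rw [Prod.dist_eq, Prod.dist_eq]; exact (le_max_right _ _).trans (le_max_right _ _)
    have : ((3 : NNReal) : ℝ) = 3 := by norm_num
    rw [this]
    simp only
    linarith
  exact key.continuous

/-- the shadow `{u | g ∈ [w,u]}` is convex -/
lemma shadow (hm : IsMedianSpace X) {g w c p u : X} (hc : g ∈ mInterval w c) (hp : g ∈ mInterval w p)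
    (hu : u ∈ mInterval c p) : g ∈ mInterval w u := by
  have hmu := gate hm (x := w) hu
  set m := med hm c p w with hmdef
  have e : med hm c p g = m :=
    med_uniq hm (med_ab hm c p g) (I_trans (I_symm hp) (med_bc hm c p g))
      (I_trans (I_symm hc) (med_ac hm c p g))
  have h1 : m ∈ mInterval c g := e ▸ med_ac hm c p g
  have h2 : g ∈ mInterval m w := I_trans' (I_symm hc) h1
  exact I_trans hmu (I_symm h2)

/-- the join of a point with a convex set -/
def pjoin (C : Set X) (p : X) : Set X := {w | ∃ c ∈ C, w ∈ mInterval c p}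

lemma pjoin_convex (hm : IsMedianSpace X) {C : Set X} (hC : MConvex C) (p : X) : MConvex (pjoin C p) := by
  rintro u ⟨c, hc, hu⟩ v ⟨d, hd, hv⟩ w hw
  set e := med hm c d w with he
  have hec : e ∈ mInterval w c := gate hm (I_left c d)
  have hed : e ∈ mInterval w d := gate hm (I_right c d)
  set g := med hm w e p with hg
  have gwe : g ∈ mInterval w e := med_ab hm _ _ _
  have gwp : g ∈ mInterval w p := med_ac hm _ _ _
  have gep : g ∈ mInterval e p := med_bc hm _ _ _
  have gu : g ∈ mInterval w u := shadow hm (I_trans hec gwe) gwp hu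
  have gv : g ∈ mInterval w v := shadow hm (I_trans hed gwe) gwp hv
  have gw : g ∈ mInterval w w := shadow hm gu gv hw
  have : g = w := I_self gw
  exact ⟨e, hC c hc d hd (med_ab hm c d w), this ▸ gep⟩

/-- A convex set and a point outside are separated by a halfspace. -/
lemma exists_halfspace (hm : IsMedianSpace X) {C : Set X} (hC : MConvex C) {y : X} (hy : y ∉ C) :
    ∃ h, IsHalfspace h ∧ C ⊆ h ∧ y ∉ h := by
  obtain ⟨M, hCM, hMax⟩ := zorn_subset_nonempty {D : Set X | MConvex D ∧ y ∉ D} (by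
    intro c hc hchain hne
    refine ⟨⋃₀ c, ⟨?_, ?_⟩, fun s hs => subset_sUnion_of_mem hs⟩
    · rintro a ⟨A, hA, haA⟩ b ⟨B, hB, hbB⟩
      rcases hchain.total hA hB with h | h
      · exact ((hc hB).1 a (h haA) b hbB).trans (subset_sUnion_of_mem hB)
      · exact ((hc hA).1 a haA b (h hbB)).trans (subset_sUnion_of_mem hA)
    · rintro ⟨A, hA, hyA⟩
      exact (hc hA).2 hyA) C ⟨hC, hy⟩
  have hMc : MConvex M := hMax.prop.1
  have hyM : y ∉ M := hMax.prop.2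
  rcases M.eq_empty_or_nonempty with hMe | ⟨c₀, hc₀⟩
  · refine ⟨M, ⟨hMc, ?_⟩, hCM, hyM⟩
    rw [hMe]; intro a _ b _ z _; simp
  have key : ∀ p ∉ M, ∃ c ∈ M, y ∈ mInterval c p := by
    intro p hp
    by_contra hcon
    have h1 : pjoin M p ∈ {D : Set X | MConvex D ∧ y ∉ D} :=
      ⟨pjoin_convex hm hMc p, fun ⟨c, hc, h⟩ => hcon ⟨c, hc, h⟩⟩
    have h2 : M ⊆ pjoin M p := fun c hc => ⟨c, hc, I_left c p⟩
    have h3 := hMax.le_of_ge h1 h2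
    exact hp (h3 ⟨c₀, hc₀, I_right c₀ p⟩)
  refine ⟨M, ⟨hMc, ?_⟩, hCM, hyM⟩
  intro p hp q hq r hr hrM
  obtain ⟨c, hc, hyc⟩ := key p hp
  obtain ⟨d, hd, hyd⟩ := key q hq
  set e := med hm c d y with he
  have hec : e ∈ mInterval y c := gate hm (I_left c d)
  have hed : e ∈ mInterval y d := gate hm (I_right c d)
  have heM : e ∈ M := hMc c hc d hd (med_ab hm c d y)
  set g := med hm y e r with hg
  have gye : g ∈ mInterval y e := med_ab hm _ _ _
  have gyr : g ∈ mInterval y r := med_ac hm _ _ _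
  have ger : g ∈ mInterval e r := med_bc hm _ _ _
  have gyc : g ∈ mInterval y c := I_trans hec gye
  have gyd : g ∈ mInterval y d := I_trans hed gye
  have hp' : y ∈ mInterval g p := I_trans' hyc (I_symm gyc)
  have hq' : y ∈ mInterval g q := I_trans' hyd (I_symm gyd)
  have hr' : y ∈ mInterval g r := shadow hm hp' hq' hr
  have : g = y := by
    rw [memI] at hr' gyr
    rw [dist_comm g y] at hr'
    exact (dist_eq_zero.1 (by linarith [dist_nonneg (x := y) (y := g)])).symm
  exact hyM (this ▸ hMc e heM r hrM ger)

lemma mem_I_iff (hm : IsMedianSpace X) {a b x : X} :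
    x ∈ mInterval a b ↔ ∀ h, IsHalfspace h → a ∈ h → b ∈ h → x ∈ h := by
  constructor
  · intro hx h hh ha hb
    exact hh.1 a ha b hb hx
  · intro H
    by_contra hx
    obtain ⟨h, hh, hC, hy⟩ := exists_halfspace hm (I_convex hm a b) hx
    exact hy (H h hh (hC (I_left a b)) (hC (I_right a b)))

lemma maj (hm : IsMedianSpace X) {h : Set X} (hh : IsHalfspace h) (a b c : X) :
    med hm a b c ∈ h ↔ (a ∈ h ∧ b ∈ h) ∨ (b ∈ h ∧ c ∈ h) ∨ (a ∈ h ∧ c ∈ h) := by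
  have h1 := med_ab hm a b c
  have h2 := med_bc hm a b c
  have h3 := med_ac hm a b c
  have p1 := fun ha hb => hh.1 a ha b hb h1
  have p2 := fun ha hb => hh.1 b ha c hb h2
  have p3 := fun ha hb => hh.1 a ha c hb h3
  have q1 := fun ha hb => hh.2 a ha b hb h1
  have q2 := fun ha hb => hh.2 b ha c hb h2
  have q3 := fun ha hb => hh.2 a ha c hb h3
  simp only [mem_compl_iff] at q1 q2 q3
  tauto

lemma sep_pts (hm : IsMedianSpace X) {a b : X} (h : a ≠ b) : ∃ k, IsHalfspace k ∧ a ∈ k ∧ b ∉ k := by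
  obtain ⟨k, hk, h1, h2⟩ := exists_halfspace hm (C := {a}) (y := b) (by
    rintro c rfl d rfl z hz
    exact I_self hz) (by simpa using h.symm)
  exact ⟨k, hk, h1 rfl, h2⟩

lemma hs_compl {h : Set X} (hh : IsHalfspace h) : IsHalfspace hᶜ :=
  ⟨hh.2, by rw [compl_compl]; exact hh.1⟩

/-- convexity of the complement, in membership form -/
lemma hs_c {h : Set X} (hh : IsHalfspace h) {a b x : X} (hx : x ∈ mInterval a b)
    (hxh : x ∈ h) : a ∈ h ∨ b ∈ h := by
  by_contra hc
  push Not at hc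
  exact hh.2 a hc.1 b hc.2 hx hxh

end Found
end MedSp
namespace MedSp

open Set Filter Topology

section Second
variable {X : Type*} [MetricSpace X]

lemma helly (hm : IsMedianSpace X) : ∀ S : List (Set X), S ≠ [] → (∀ A ∈ S, MConvex A) →
    (∀ A ∈ S, ∀ B ∈ S, (A ∩ B).Nonempty) → ∃ p, ∀ A ∈ S, p ∈ A := by
  intro S
  induction hn : S.length generalizing S with
  | zero => intro h; exact absurd (List.length_eq_zero_iff.1 hn) h
  | succ N ih =>
    match S, hn with
    | A :: T, hn =>
      intro _ hc hp
      by_cases hT : T = []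
      · subst hT
        obtain ⟨p, hp⟩ := hp A (by simp) A (by simp)
        exact ⟨p, by simpa using hp.1⟩
      have hcA : MConvex A := hc A (by simp)
      obtain ⟨p, hp'⟩ := ih (T.map (A ∩ ·)) (by simpa using hn) (by simpa using hT) (by
        intro B hB
        obtain ⟨B, hBT, rfl⟩ := List.mem_map.1 hB
        intro a ha b hb z hz
        exact ⟨hcA a ha.1 b hb.1 hz, hc B (List.mem_cons_of_mem _ hBT) a ha.2 b hb.2 hz⟩) (by
        intro B hB B' hB'
        obtain ⟨B, hBT, rfl⟩ := List.mem_map.1 hB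
        obtain ⟨B', hBT', rfl⟩ := List.mem_map.1 hB'
        obtain ⟨x, hx⟩ := hp A (by simp) B (List.mem_cons_of_mem _ hBT)
        obtain ⟨y, hy⟩ := hp A (by simp) B' (List.mem_cons_of_mem _ hBT')
        obtain ⟨z, hz⟩ := hp B (List.mem_cons_of_mem _ hBT) B' (List.mem_cons_of_mem _ hBT')
        have h1 := hcA x hx.1 y hy.1 (med_ab hm x y z)
        have h2 := hc B' (List.mem_cons_of_mem _ hBT') y hy.2 z hz.2 (med_bc hm x y z)
        have h3 := hc B (List.mem_cons_of_mem _ hBT) x hx.2 z hz.1 (med_ac hm x y z)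
        exact ⟨_, ⟨h1, h3⟩, ⟨h1, h2⟩⟩)
      refine ⟨p, ?_⟩
      intro B hB
      rcases List.mem_cons.1 hB with rfl | hB
      · obtain ⟨B', hB'⟩ := List.exists_mem_of_ne_nil T hT
        exact (hp' _ (List.mem_map.2 ⟨B', hB', rfl⟩)).1
      · exact (hp' _ (List.mem_map.2 ⟨B, hB, rfl⟩)).2

/-- Bound on the rank, in list form. -/
def RankLe (X : Type*) [MetricSpace X] (n : ℕ) : Prop :=
  ∀ L : List (Set X), (∀ h ∈ L, IsHalfspace h) → L.Pairwise TransverseSets → L.length ≤ n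

lemma trans_symm {h k : Set X} (H : TransverseSets h k) : TransverseSets k h := by
  obtain ⟨h1, h2, h3, h4⟩ := H
  exact ⟨by rwa [inter_comm], by rwa [inter_comm], by rwa [inter_comm], by rwa [inter_comm]⟩

lemma rankLe_of {n : ℕ} (hr : HasMedianRank X n) : RankLe X n := by
  intro L hL hP
  by_contra hlt
  push Not at hlt
  refine hr.2 ⟨fun i => L.get ⟨i.1, by omega⟩, fun i => hL _ (List.get_mem _ _), ?_⟩
  intro i j hij
  rcases lt_or_gt_of_ne hij with h | h
  · exact List.pairwise_iff_get.1 hP _ _ h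
  · exact trans_symm (List.pairwise_iff_get.1 hP _ _ h)

/-- The combinatorial obstruction coming from finite rank. -/
lemma pairs_bound (hm : IsMedianSpace X) {n : ℕ} (hr : RankLe X n) {a b : X} (L : List (X × X))
    (hL : ∀ q ∈ L, q.1 ∈ mInterval a b ∧ q.1 ∉ mInterval a q.2)
    (hP : L.Pairwise (fun q r => q.1 ∈ mInterval a r.2 ∧ r.1 ∈ mInterval a q.2)) :
    L.length ≤ n := by
  classical
  have H : ∀ q : X × X, ∃ g : Set X, q ∈ L → IsHalfspace g ∧ a ∉ g ∧ q.2 ∉ g ∧ q.1 ∈ g ∧ b ∈ g := by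
    intro q
    by_cases hq : q ∈ L
    · obtain ⟨g, hg, h1, h2⟩ := exists_halfspace hm (I_convex hm a q.2) (hL q hq).2
      refine ⟨gᶜ, fun _ => ⟨hs_compl hg, ?_, ?_, h2, ?_⟩⟩
      · exact fun h => h (h1 (I_left _ _))
      · exact fun h => h (h1 (I_right _ _))
      · intro hb
        exact h2 (hg.1 a (h1 (I_left _ _)) b hb (hL q hq).1)
    · exact ⟨∅, fun h => absurd h hq⟩
  choose g hg using H
  have := hr (L.map g) (by
    intro h hh
    obtain ⟨q, hq, rfl⟩ := List.mem_map.1 hh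
    exact (hg q hq).1) (by
    rw [List.pairwise_map]
    refine List.Pairwise.imp_of_mem ?_ hP
    intro q r hq hr' hqr
    obtain ⟨q0, q1, q2, q3, q4⟩ := hg q hq
    obtain ⟨r0, r1, r2, r3, r4⟩ := hg r hr'
    refine ⟨⟨b, q4, r4⟩, ⟨r.1, ?_, r3⟩, ⟨q.1, q3, ?_⟩, ⟨a, q1, r1⟩⟩
    · exact q0.2 a q1 _ q2 hqr.2
    · exact r0.2 a r1 _ r2 hqr.1)
  simpa using this

lemma chain_lemma (hm : IsMedianSpace X) {n : ℕ} (hr : RankLe X n) {a b : X} (t : ℕ → X)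
    (ht : ∀ i, t i ∈ mInterval a (t (i + 1))) (htb : ∀ i, t i ∈ mInterval a b)
    (k : ℕ → Set X) (hk : ∀ i, IsHalfspace (k i)) (hk1 : ∀ i, t i ∈ k i)
    (hk2 : ∀ i, t (i + 1) ∉ k i) : ∃ i, a ∈ interior (k i) := by
  by_contra hcon
  push Not at hcon
  have hcl : ∀ i, a ∈ closure (k i)ᶜ := fun i => by
    rw [closure_compl]; exact hcon i
  have main : ∀ j : ℕ, ∃ L : List (X × X), L.length = j ∧
      (∀ q ∈ L, q.1 ∈ mInterval a (t j) ∧ q.1 ∉ mInterval a q.2 ∧ q.2 ∈ mInterval a b) ∧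
      L.Pairwise (fun q r => q.1 ∈ mInterval a r.2 ∧ r.1 ∈ mInterval a q.2) := by
    intro j
    induction j with
    | zero => exact ⟨[], by simp⟩
    | succ j ih =>
      obtain ⟨L, hlen, hL, hP⟩ := ih
      have hev : ∀ᶠ s in 𝓝 a, ∀ q ∈ {q | q ∈ L}, q.1 ∉ mInterval a (med hm b q.2 s) := by
        rw [Filter.eventually_all_finite (List.finite_toSet L)]
        intro q hq
        have hc : Continuous (fun s => dist a q.1 + dist q.1 (med hm b q.2 s)
            - dist a (med hm b q.2 s)) := by
          have : Continuous (fun s => med hm b q.2 s) :=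
            (med_cont hm).comp (by fun_prop : Continuous fun s : X => (b, q.2, s))
          fun_prop
        have h0 : med hm b q.2 a = q.2 := by
          symm
          exact med_uniq hm (I_right _ _) (I_left _ _) (I_symm (hL q hq).2.2)
        have hne : (dist a q.1 + dist q.1 (med hm b q.2 a) - dist a (med hm b q.2 a)) ≠ 0 := by
          rw [h0]
          intro h
          exact (hL q hq).2.1 (by rw [memI]; linarith)
        filter_upwards [hc.continuousAt.eventually_ne hne] with s hs hmem
        rw [memI] at hmem
        apply hs; linarith
      obtain ⟨s, hsk, hsL⟩ : ∃ s, s ∈ (k j)ᶜ ∧ ∀ q ∈ L, q.1 ∉ mInterval a (med hm b q.2 s) := by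
        have := (mem_closure_iff_frequently.1 (hcl j)).and_eventually hev
        obtain ⟨s, hs⟩ := this.exists
        exact ⟨s, hs.1, hs.2⟩
      have mono : ∀ q ∈ L, ∀ p ∈ mInterval a q.2, p ∈ mInterval a (med hm b q.2 s) := by
        intro q hq p hp
        have hqb := (hL q hq).2.2
        rw [mem_I_iff hm] at hp hqb ⊢
        intro h hh ha hw
        rw [maj hm hh] at hw
        have := hp h hh ha
        have := hqb h hh ha
        tauto
      refine ⟨(med hm a s (t (j + 1)), t j) :: L.map (fun q => (q.1, med hm b q.2 s)),
        by simp [hlen], ?_, ?_⟩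
      · have hak : a ∈ k j := by
          rcases hs_c (hk j) (ht j) (hk1 j) with h | h
          · exact h
          · exact absurd h (hk2 j)
        intro q hq
        rcases List.mem_cons.1 hq with rfl | hq
        · refine ⟨med_ac hm _ _ _, ?_, htb j⟩
          intro hmem
          have h1 := (hk j).1 a hak _ (hk1 j) hmem
          rw [maj hm (hk j)] at h1
          have := hk2 j
          have : s ∉ k j := hsk
          tauto
        · obtain ⟨q, hqL, rfl⟩ := List.mem_map.1 hq
          refine ⟨I_trans (ht j) (hL q hqL).1, hsL q hqL, ?_⟩
          have hqb := (hL q hqL).2.2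
          rw [mem_I_iff hm] at hqb ⊢
          intro h hh ha hb
          rw [maj hm hh]
          have := hqb h hh ha hb
          tauto
      · rw [List.pairwise_cons]
        constructor
        · intro q hq
          obtain ⟨q, hqL, rfl⟩ := List.mem_map.1 hq
          refine ⟨?_, (hL q hqL).1⟩
          have htb' := htb (j + 1)
          rw [mem_I_iff hm] at htb' ⊢
          intro h hh ha hw
          rw [maj hm hh] at hw ⊢
          have := htb' h hh ha
          tauto
        · rw [List.pairwise_map]
          refine List.Pairwise.imp_of_mem ?_ hP
          intro q r hq hr' hqr
          exact ⟨mono r hr' _ hqr.1, mono q hq _ hqr.2⟩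
  obtain ⟨L, hlen, hL, hP⟩ := main (n + 1)
  have := pairs_bound hm hr L (fun q hq => ⟨I_trans (htb _) (hL q hq).1, (hL q hq).2.1⟩) hP
  omega

end Second
end MedSp
namespace MedSp

open Set Filter Topology

section Third
variable {X : Type*} [MetricSpace X]

lemma med_cont3 (hm : IsMedianSpace X) (a b : X) : Continuous (fun s => med hm a b s) :=
  (med_cont hm).comp (by fun_prop : Continuous fun s : X => (a, b, s))

lemma between (hm : IsMedianSpace X) [ConnectedSpace X] (a b : X) {r : ℝ} (h0 : 0 ≤ r) (h1 : r ≤ dist a b) :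
    ∃ c ∈ mInterval a b, dist a c = r := by
  have hc : Continuous (fun s => dist a (med hm a b s)) := by
    have := med_cont3 hm a b
    fun_prop
  have := intermediate_value_univ a b hc
  simp only [med_eq_of_mem hm (I_left a b), med_eq_of_mem hm (I_right a b), dist_self] at this
  obtain ⟨s, hs⟩ := this ⟨h0, h1⟩
  exact ⟨_, med_ab hm a b s, hs⟩

lemma strict_between (hm : IsMedianSpace X) [ConnectedSpace X] {a b : X} (hab : a ≠ b) :
    ∃ c ∈ mInterval a b, c ≠ a ∧ c ≠ b := by
  have hd : 0 < dist a b := dist_pos.2 hab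
  obtain ⟨c, hc, h⟩ := between hm a b (r := dist a b / 2) (by linarith) (by linarith)
  refine ⟨c, hc, ?_, ?_⟩
  · rintro rfl
    rw [dist_self] at h; linarith
  · rintro rfl
    linarith

lemma chain_seq (hm : IsMedianSpace X) [ConnectedSpace X] {a b : X} (hab : a ≠ b) :
    ∃ t : ℕ → X, t 0 = a ∧ ∀ i, t i ∈ mInterval a (t (i + 1)) ∧ t i ∈ mInterval a b ∧
      t (i + 1) ∈ mInterval (t i) b ∧ t (i + 1) ≠ t i ∧ t i ≠ b := by
  have : ∀ x : X, ∃ y, x ≠ b → y ∈ mInterval x b ∧ y ≠ x ∧ y ≠ b := by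
    intro x
    by_cases h : x = b
    · exact ⟨x, fun h' => absurd h h'⟩
    · obtain ⟨c, hc⟩ := strict_between hm h
      exact ⟨c, fun _ => hc⟩
  choose f hf using this
  let t : ℕ → X := fun i => Nat.rec a (fun _ x => f x) i
  have ht : ∀ i, t (i + 1) = f (t i) := fun i => rfl
  have hne : ∀ i, t i ≠ b := by
    intro i
    induction i with
    | zero => exact hab
    | succ i ih => rw [ht]; exact (hf _ ih).2.2
  have hI : ∀ i, t i ∈ mInterval a b := by
    intro i
    induction i with
    | zero => exact I_left _ _
    | succ i ih =>
      rw [ht]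
      exact I_symm (I_trans (I_symm ih) (I_symm (hf _ (hne i)).1))
  refine ⟨t, rfl, fun i => ⟨?_, hI i, ?_, ?_, hne i⟩⟩
  · rw [ht]
    exact I_symm (I_trans' (I_symm (hI i)) (I_symm (hf _ (hne i)).1))
  · rw [ht]; exact (hf _ (hne i)).1
  · rw [ht]; exact (hf _ (hne i)).2.1

lemma R1 (hm : IsMedianSpace X) [ConnectedSpace X] {n : ℕ} (hr : RankLe X n) {a b : X} (hab : a ≠ b) :
    ∃ k, IsHalfspace k ∧ a ∈ interior k ∧ b ∉ k := by
  obtain ⟨t, h0, ht⟩ := chain_seq hm hab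
  choose k hk hk1 hk2 using fun i => sep_pts hm (ht i).2.2.2.1.symm
  obtain ⟨i, hi⟩ := chain_lemma hm hr t (fun i => (ht i).1) (fun i => (ht i).2.1) k hk hk1 hk2
  refine ⟨k i, hk i, hi, fun hb => hk2 i ?_⟩
  exact (hk i).1 _ (hk1 i) _ hb (ht i).2.2.1

lemma R2 (hm : IsMedianSpace X) [ConnectedSpace X] {n : ℕ} (hr : RankLe X n) {a b : X} (hab : a ≠ b) :
    ∃ k, IsHalfspace k ∧ a ∈ interior k ∧ b ∈ interior kᶜ := by
  obtain ⟨t, h0, ht⟩ := chain_seq hm hab.symm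
  choose k hk hk1 hk2 using fun i => R1 hm hr (ht i).2.2.2.1
  obtain ⟨i, hi⟩ := chain_lemma hm hr t (fun i => (ht i).1) (fun i => (ht i).2.1)
    (fun i => (k i)ᶜ) (fun i => hs_compl (hk i)) hk2
    (fun i h => h (interior_subset (hk1 i)))
  refine ⟨k i, hk i, ?_, hi⟩
  rw [mem_interior]
  refine ⟨(fun s => med hm (t (i + 1)) (t i) s) ⁻¹' interior (k i), ?_,
    isOpen_interior.preimage (med_cont3 hm _ _), ?_⟩
  · intro s hs
    have hs' := interior_subset (mem_preimage.1 hs)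
    rw [maj hm (hk i)] at hs'
    have := hk2 i
    tauto
  · have : t (i + 1) = med hm (t (i + 1)) (t i) a :=
      med_uniq hm (I_left _ _) (ht i).2.2.1 (I_left _ _)
    rw [mem_preimage, ← this]
    exact hk1 i

lemma proper_of (hm : IsMedianSpace X) [ConnectedSpace X] [LocallyCompactSpace X]
    (htrans : ∀ x y : X, ∃ f : X → X, Isometry f ∧ Function.Surjective f ∧ f x = y) :
    ProperSpace X := by
  obtain ⟨x0⟩ := (inferInstance : Nonempty X)
  obtain ⟨K, hK, hKn⟩ := exists_compact_mem_nhds x0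
  obtain ⟨r, hr, hrK⟩ := Metric.nhds_basis_closedBall.mem_iff.1 hKn
  have hball : ∀ y : X, IsCompact (Metric.closedBall y r) := by
    intro y
    obtain ⟨g, hg, hs, hgy⟩ := htrans x0 y
    refine (hK.image hg.continuous).of_isClosed_subset Metric.isClosed_closedBall ?_
    intro z hz
    obtain ⟨w, rfl⟩ := hs z
    refine ⟨w, hrK ?_, rfl⟩
    rw [Metric.mem_closedBall, ← hgy, hg.dist_eq] at hz
    exact hz
  have step : ∀ (x : X) (m : ℕ), IsCompact (Metric.closedBall x (m * (r / 2))) := by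
    intro x m
    induction m with
    | zero => simp
    | succ m ih =>
      obtain ⟨T, hT, hTf, hcov⟩ := ih.finite_cover_balls (e := r / 2) (by linarith)
      refine (hTf.isCompact_biUnion (fun c _ => hball c)).of_isClosed_subset
        Metric.isClosed_closedBall ?_
      intro y hy
      rw [Metric.mem_closedBall, dist_comm] at hy
      push_cast at hy
      have hm0 : (0 : ℝ) ≤ m * (r / 2) := by positivity
      obtain ⟨z, hz, hzr⟩ := between hm x y (r := min (m * (r / 2)) (dist x y))
        (le_min hm0 dist_nonneg) (min_le_right _ _)
      have hzK : z ∈ Metric.closedBall x (m * (r / 2)) := by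
        rw [Metric.mem_closedBall, dist_comm, hzr]; exact min_le_left _ _
      have hzy : dist z y ≤ r / 2 := by
        rw [memI, hzr] at hz
        rcases min_cases (m * (r / 2)) (dist x y) with h | h <;> rw [h.1] at hz <;> linarith
      obtain ⟨c, hc, hzc⟩ := mem_iUnion₂.1 (hcov hzK)
      refine mem_iUnion₂.2 ⟨c, hc, ?_⟩
      rw [Metric.mem_ball] at hzc
      rw [Metric.mem_closedBall]
      have := dist_triangle y z c
      rw [dist_comm y z] at this
      linarith
  refine ⟨fun x ρ => ?_⟩
  obtain ⟨m, hmρ⟩ := exists_nat_ge (ρ / (r / 2))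
  refine (step x m).of_isClosed_subset Metric.isClosed_closedBall
    (Metric.closedBall_subset_closedBall ?_)
  rwa [div_le_iff₀ (by linarith)] at hmρ

/-- Compact convex hull of a finite set. -/
lemma finite_hull (hm : IsMedianSpace X) [ProperSpace X] {F : Set X} (hF : F.Finite) (hne : F.Nonempty) :
    ∃ K : Set X, IsCompact K ∧ MConvex K ∧ F ⊆ K ∧ ∀ C, MConvex C → F ⊆ C → K ⊆ C := by
  induction F, hF using Set.Finite.induction_on with
  | empty => exact absurd hne (by simp)
  | @insert p F hp hF ih =>
    by_cases hFe : F.Nonempty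
    · obtain ⟨K, hK, hKc, hFK, hmin⟩ := ih hFe
      obtain ⟨f, hf⟩ := hFe
      refine ⟨pjoin K p, ?_, pjoin_convex hm hKc p, ?_, ?_⟩
      · obtain ⟨R, hR⟩ := hK.isBounded.subset_closedBall p
        have him : pjoin K p = (fun q : X × X => med hm q.1 p q.2) ''
            (K ×ˢ Metric.closedBall p R) := by
          ext w
          constructor
          · rintro ⟨c, hc, hw⟩
            refine ⟨(c, w), ⟨hc, ?_⟩, med_eq_of_mem hm hw⟩
            have := hR hc
            rw [Metric.mem_closedBall] at this ⊢
            rw [memI] at hw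
            have := dist_nonneg (x := c) (y := w)
            linarith
          · rintro ⟨⟨c, w⟩, ⟨hc, hw⟩, rfl⟩
            exact ⟨c, hc, med_ab hm _ _ _⟩
        rw [him]
        refine (hK.prod (isCompact_closedBall p R)).image ?_
        exact (med_cont hm).comp (by fun_prop : Continuous fun q : X × X => (q.1, p, q.2))
      · intro w hw
        rcases hw with rfl | hw
        · exact ⟨f, hFK hf, I_right _ _⟩
        · exact ⟨w, hFK hw, I_left _ _⟩
      · rintro C hC hsub w ⟨c, hc, hw⟩
        exact hC c (hmin C hC (fun x hx => hsub (mem_insert_of_mem _ hx)) hc) p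
          (hsub (mem_insert _ _)) hw
    · rw [not_nonempty_iff_eq_empty] at hFe
      subst hFe
      refine ⟨{p}, isCompact_singleton, ?_, by simp, ?_⟩
      · rintro c rfl d rfl z hz
        exact I_self hz
      · intro C _ h
        simpa using h

end Third
end MedSp
namespace MedSp

open Set Filter Topology

/-- Transversality witnessed by a set `F`. -/
def TransF {X : Type*} (F : Set X) (h k : Set X) : Prop :=
  ∀ σ τ : Prop, ∃ f ∈ F, (f ∈ h ↔ σ) ∧ (f ∈ k ↔ τ)

/-- A family of pairwise transverse halfspaces witnessed by the finite set `F`. -/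
def Good {X : Type*} [MetricSpace X] (L : List (Set X)) (F : Set X) : Prop :=
  F.Finite ∧ F.Nonempty ∧ (∀ k ∈ L, IsHalfspace k ∧ ∀ σ : Prop, ∃ f ∈ F, (f ∈ k ↔ σ)) ∧
    L.Pairwise (TransF F)

section Fourth
variable {X : Type*} [MetricSpace X]

lemma TransF.trans {F h k : Set X} (H : TransF F h k) : TransverseSets h k := by
  obtain ⟨x, -, hx⟩ := H True True
  obtain ⟨y, -, hy⟩ := H False True
  obtain ⟨z, -, hz⟩ := H True False
  obtain ⟨w, -, hw⟩ := H False False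
  exact ⟨⟨x, by simpa using hx⟩, ⟨y, by simpa using hy⟩, ⟨z, by simpa using hz⟩,
    ⟨w, by simpa using hw⟩⟩

lemma Good.le {n : ℕ} (hr : RankLe X n) {L : List (Set X)} {F : Set X} (H : Good L F) :
    L.length ≤ n :=
  hr L (fun k hk => (H.2.2.1 k hk).1) (H.2.2.2.imp (fun h => h.trans))


lemma lemG (hm : IsMedianSpace X) [ProperSpace X] {F k : Set X} (hF : F.Finite) (hk : IsHalfspace k)
    (h1 : ∃ f ∈ F, f ∈ k) (h2 : ∃ f ∈ F, f ∉ k) :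
    ∃ a b, a ≠ b ∧ (∀ f ∈ F, f ∈ k → a ∈ mInterval f b) ∧
      (∀ f ∈ F, f ∉ k → b ∈ mInterval f a) := by
  obtain ⟨f1, hf1, hf1k⟩ := h1
  obtain ⟨f2, hf2, hf2k⟩ := h2
  obtain ⟨A, hA, hAc, hFA, hAm⟩ := finite_hull hm (hF.inter_of_left k) ⟨f1, hf1, hf1k⟩
  obtain ⟨B, hB, hBc, hFB, hBm⟩ := finite_hull hm (hF.inter_of_left kᶜ) ⟨f2, hf2, hf2k⟩
  have hAk := hAm k hk.1 (fun x hx => hx.2)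
  have hBk := hBm kᶜ hk.2 (fun x hx => hx.2)
  obtain ⟨⟨a, b⟩, ⟨ha, hb⟩, hmin⟩ := (hA.prod hB).exists_isMinOn
    ⟨(f1, f2), hFA ⟨hf1, hf1k⟩, hFB ⟨hf2, hf2k⟩⟩
    (f := fun q : X × X => dist q.1 q.2) (by fun_prop)
  have hmin' : ∀ a' ∈ A, ∀ b' ∈ B, dist a b ≤ dist a' b' := fun a' ha' b' hb' =>
    isMinOn_iff.1 hmin (a', b') ⟨ha', hb'⟩
  refine ⟨a, b, ?_, ?_, ?_⟩
  · rintro rfl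
    exact hBk hb (hAk ha)
  · intro f hf hfk
    have hmem := hAc a ha f (hFA ⟨hf, hfk⟩) (med_ab hm a f b)
    have h3 := hmin' _ hmem b hb
    have h4 := med_ac hm a f b
    rw [memI] at h4
    have : dist a (med hm a f b) = 0 := le_antisymm (by linarith) dist_nonneg
    rw [dist_eq_zero.1 this]
    exact med_bc hm a f b
  · intro f hf hfk
    have hmem := hBc b hb f (hFB ⟨hf, hfk⟩) (med_ab hm b f a)
    have h3 := hmin' a ha _ hmem
    have h4 := med_ac hm b f a
    rw [memI] at h4
    rw [dist_comm a b, dist_comm a] at h3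
    have : dist b (med hm b f a) = 0 := le_antisymm (by linarith) dist_nonneg
    rw [dist_eq_zero.1 this]
    exact med_bc hm b f a

lemma agree {F k κ : Set X} {a b : X} (hκ : IsHalfspace κ) (ha : a ∈ κ) (hb : b ∉ κ)
    (h1 : ∀ f ∈ F, f ∈ k → a ∈ mInterval f b) (h2 : ∀ f ∈ F, f ∉ k → b ∈ mInterval f a) :
    ∀ f ∈ F, (f ∈ κ ↔ f ∈ k) := by
  intro f hf
  constructor
  · intro h
    by_contra hk
    exact hb (hκ.1 f h a ha (h2 f hf hk))
  · intro h
    rcases hs_c hκ (h1 f hf h) ha with h | h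
    · exact h
    · exact absurd h hb

lemma kaplam (hm : IsMedianSpace X) [ConnectedSpace X] [ProperSpace X] {F k : Set X} (hF : F.Finite)
    (hk : IsHalfspace k) (h1 : ∃ f ∈ F, f ∈ k) (h2 : ∃ f ∈ F, f ∉ k) :
    ∃ κ l : Set X, IsHalfspace κ ∧ IsHalfspace l ∧ (∀ f ∈ F, (f ∈ κ ↔ f ∈ k)) ∧
      (∀ f ∈ F, (f ∈ l ↔ f ∈ k)) ∧ (l ∩ κᶜ).Nonempty := by
  obtain ⟨a, b, hab, ha, hb⟩ := lemG hm hF hk h1 h2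
  obtain ⟨c, hc, hca, hcb⟩ := strict_between hm hab
  obtain ⟨κ, hκ, haκ, hcκ⟩ := sep_pts hm hca.symm
  obtain ⟨l, hl, hcl, hbl⟩ := sep_pts hm hcb
  have hbκ : b ∉ κ := fun h => hcκ (hκ.1 a haκ b h hc)
  have hal : a ∈ l := by
    rcases hs_c hl hc hcl with h | h
    · exact h
    · exact absurd h hbl
  exact ⟨κ, l, hκ, hl, agree hκ haκ hbκ ha hb, agree hl hal hbl ha hb, c, hcl, hcκ⟩

lemma int_proj (hm : IsMedianSpace X) {k : Set X} (hk : IsHalfspace k) {a b f : X} (ha : a ∈ interior k)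
    (hb : b ∉ k) (hf : a ∈ mInterval f b) : f ∈ interior k := by
  rw [mem_interior]
  refine ⟨(fun s => med hm a b s) ⁻¹' interior k, ?_,
    isOpen_interior.preimage (med_cont3 hm _ _), ?_⟩
  · intro s hs
    have hs' := interior_subset (mem_preimage.1 hs)
    rw [maj hm hk] at hs'
    tauto
  · have : a = med hm a b f :=
      med_uniq hm (I_left _ _) (I_symm hf) (I_left _ _)
    rw [mem_preimage, ← this]
    exact ha

lemma robust (hm : IsMedianSpace X) [ConnectedSpace X] [ProperSpace X] {n : ℕ} (hr : RankLe X n) {F k : Set X}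
    (hF : F.Finite)
    (hk : IsHalfspace k) (h1 : ∃ f ∈ F, f ∈ k) (h2 : ∃ f ∈ F, f ∉ k) :
    ∃ r : Set X, IsHalfspace r ∧ ∀ f ∈ F, ∀ᶠ s in 𝓝 f, (s ∈ r ↔ f ∈ k) := by
  obtain ⟨a, b, hab, ha, hb⟩ := lemG hm hF hk h1 h2
  obtain ⟨r, hr, har, hbr⟩ := R2 hm hr hab
  refine ⟨r, hr, fun f hf => ?_⟩
  by_cases hfk : f ∈ k
  · have := int_proj hm hr har (interior_subset hbr) (ha f hf hfk)
    filter_upwards [isOpen_interior.mem_nhds this] with s hs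
    exact ⟨fun _ => hfk, fun _ => interior_subset hs⟩
  · have := int_proj hm (hs_compl hr) hbr (fun h => h (interior_subset har)) (hb f hf hfk)
    filter_upwards [isOpen_interior.mem_nhds this] with s hs
    exact ⟨fun h => absurd h (interior_subset hs), fun h => absurd h hfk⟩

lemma PL (hm : IsMedianSpace X) [ConnectedSpace X] [ProperSpace X] {n : ℕ} (hr : RankLe X n) {L : List (Set X)}
    {F h V : Set X} (H : Good L F) (hh : IsHalfspace h) (hFh : F ⊆ closure h ∩ closure hᶜ)
    (hV : IsOpen V) (hFV : F ⊆ V) :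
    ∃ L' F', Good L' F' ∧ F' ⊆ V ∧ L'.length = L.length + 1 := by
  obtain ⟨hF, ⟨f0, hf0⟩, hL, hP⟩ := H
  have : ∀ k, ∃ r, k ∈ L → IsHalfspace r ∧ ∀ f ∈ F, ∀ᶠ s in 𝓝 f, (s ∈ r ↔ f ∈ k) := by
    intro k
    by_cases hk : k ∈ L
    · obtain ⟨hk1, hk2⟩ := hL k hk
      obtain ⟨f1, hf1, hf1k⟩ := hk2 True
      obtain ⟨f2, hf2, hf2k⟩ := hk2 False
      obtain ⟨r, hr⟩ := robust hm hr hF hk1 ⟨f1, hf1, by simpa using hf1k⟩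
        ⟨f2, hf2, by simpa using hf2k⟩
      exact ⟨r, fun _ => hr⟩
    · exact ⟨∅, fun h => absurd h hk⟩
  choose r hr using this
  have key : ∀ f, ∃ u w, f ∈ F → u ∈ h ∧ w ∉ h ∧ u ∈ V ∧ w ∈ V ∧
      ∀ k ∈ L, (u ∈ r k ↔ f ∈ k) ∧ (w ∈ r k ↔ f ∈ k) := by
    intro f
    by_cases hf : f ∈ F
    · have hev : ∀ᶠ s in 𝓝 f, s ∈ V ∧ ∀ k ∈ {k | k ∈ L}, (s ∈ r k ↔ f ∈ k) := by
        refine Filter.Eventually.and (hV.mem_nhds (hFV hf)) ?_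
        rw [Filter.eventually_all_finite (List.finite_toSet L)]
        exact fun k hk => (hr k hk).2 f hf
      obtain ⟨u, hu⟩ := ((mem_closure_iff_frequently.1 (hFh hf).1).and_eventually hev).exists
      obtain ⟨w, hw⟩ := ((mem_closure_iff_frequently.1 (hFh hf).2).and_eventually hev).exists
      exact ⟨u, w, fun _ => ⟨hu.1, hw.1, hu.2.1, hw.2.1,
        fun k hk => ⟨hu.2.2 k hk, hw.2.2 k hk⟩⟩⟩
    · exact ⟨f, f, fun h => absurd h hf⟩
  choose u w huw using key
  refine ⟨h :: L.map r, u '' F ∪ w '' F, ⟨(hF.image u).union (hF.image w),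
    ⟨u f0, Or.inl ⟨f0, hf0, rfl⟩⟩, ?_, ?_⟩, ?_, by simp⟩
  · intro k hk
    rcases List.mem_cons.1 hk with rfl | hk
    · refine ⟨hh, fun σ => ?_⟩
      have := huw f0 hf0
      by_cases hσ : σ
      · exact ⟨u f0, Or.inl ⟨f0, hf0, rfl⟩, by tauto⟩
      · exact ⟨w f0, Or.inr ⟨f0, hf0, rfl⟩, by tauto⟩
    · obtain ⟨k, hkL, rfl⟩ := List.mem_map.1 hk
      refine ⟨(hr k hkL).1, fun σ => ?_⟩
      obtain ⟨f, hf, hfσ⟩ := (hL k hkL).2 σ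
      exact ⟨u f, Or.inl ⟨f, hf, rfl⟩, (((huw f hf).2.2.2.2 k hkL).1).trans hfσ⟩
  · rw [List.pairwise_cons]
    constructor
    · intro k hk σ τ
      obtain ⟨k, hkL, rfl⟩ := List.mem_map.1 hk
      obtain ⟨f, hf, hfσ⟩ := (hL k hkL).2 τ
      obtain ⟨h1, h2, -, -, h3⟩ := huw f hf
      have := h3 k hkL
      by_cases hσ : σ
      · exact ⟨u f, Or.inl ⟨f, hf, rfl⟩, by tauto, by tauto⟩
      · exact ⟨w f, Or.inr ⟨f, hf, rfl⟩, by tauto, by tauto⟩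
    · rw [List.pairwise_map]
      refine List.Pairwise.imp_of_mem ?_ hP
      intro k l hk hl hkl σ τ
      obtain ⟨f, hf, h1, h2⟩ := hkl σ τ
      have h3 := (huw f hf).2.2.2.2
      exact ⟨u f, Or.inl ⟨f, hf, rfl⟩, (h3 k hk).1.trans h1, (h3 l hl).1.trans h2⟩
  · rintro x (⟨f, hf, rfl⟩ | ⟨f, hf, rfl⟩)
    · exact (huw f hf).2.2.1
    · exact (huw f hf).2.2.2.1

/-- Hyperplanes are nowhere dense. -/
lemma hyper_nd (hm : IsMedianSpace X) [ConnectedSpace X] [ProperSpace X] {n : ℕ} (hr : RankLe X n) {h : Set X}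
    (hh : IsHalfspace h) : interior (closure h ∩ closure hᶜ) = ∅ := by
  by_contra hne
  obtain ⟨v, hv⟩ := nonempty_iff_ne_empty.2 hne
  have : ∀ N : ℕ, ∃ L F, Good L F ∧ F ⊆ interior (closure h ∩ closure hᶜ) ∧ L.length = N := by
    intro N
    induction N with
    | zero => exact ⟨[], {v}, ⟨by simp, by simp, by simp, by simp⟩, by simpa using hv, rfl⟩
    | succ N ih =>
      obtain ⟨L, F, hG, hFV, hN⟩ := ih
      obtain ⟨L', F', h1, h2, h3⟩ := PL hm hr hG hh (hFV.trans interior_subset)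
        isOpen_interior hFV
      exact ⟨L', F', h1, h2, by omega⟩
  obtain ⟨L, F, hG, -, hN⟩ := this (n + 1)
  have := hG.le hr
  omega

/-- Thin halfspaces cannot exist through every point. -/
lemma no_thin (hm : IsMedianSpace X) [ConnectedSpace X] [ProperSpace X] {n : ℕ} (hr : RankLe X n) :
    ¬ ∀ p : X, ∃ h, IsHalfspace h ∧ p ∈ h ∧ Dense hᶜ := by
  intro hthin
  obtain ⟨v⟩ := (inferInstance : Nonempty X)
  have : ∀ N : ℕ, ∃ (L : List (Set X)) (F : Set X), Good L F ∧ L.length = N := by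
    intro N
    induction N with
    | zero => exact ⟨[], {v}, ⟨by simp, by simp, by simp, by simp⟩, rfl⟩
    | succ N ih =>
      obtain ⟨L, F, ⟨hF, hFne, hL, hP⟩, hN⟩ := ih
      have : ∀ k, ∃ κ l : Set X, k ∈ L → IsHalfspace κ ∧ IsHalfspace l ∧
          (∀ f ∈ F, (f ∈ κ ↔ f ∈ k)) ∧
          (∀ f ∈ F, (f ∈ l ↔ f ∈ k)) ∧ (l ∩ κᶜ).Nonempty := by
        intro k
        by_cases hk : k ∈ L
        · obtain ⟨hk1, hk2⟩ := hL k hk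
          obtain ⟨f1, hf1, hf1k⟩ := hk2 True
          obtain ⟨f2, hf2, hf2k⟩ := hk2 False
          obtain ⟨κ, l, h⟩ := kaplam hm hF hk1 ⟨f1, hf1, by simpa using hf1k⟩
            ⟨f2, hf2, by simpa using hf2k⟩
          exact ⟨κ, l, fun _ => h⟩
        · exact ⟨∅, ∅, fun h => absurd h hk⟩
      choose κ l hκl using this
      obtain ⟨K, hK, hKc, hFK, hKm⟩ := finite_hull hm hF hFne
      obtain ⟨f0, hf0⟩ := hFne
      -- the pairwise statement for arbitrary members of L
      have hpair : ∀ k ∈ L, ∀ k' ∈ L, k = k' ∨ TransF F k k' := by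
        intro k hk k' hk'
        have : Std.Symm (TransF F) := ⟨by
          intro x y h σ τ
          obtain ⟨f, hf, h1, h2⟩ := h τ σ
          exact ⟨f, hf, h2, h1⟩⟩
        by_cases hkk : k = k'
        · exact Or.inl hkk
        · exact Or.inr (hP.forall hk hk' hkk)
      obtain ⟨p, hp⟩ : ∃ p, p ∈ K ∧ ∀ k ∈ L, p ∈ l k ∧ p ∉ κ k := by
        obtain ⟨p, hp⟩ := helly hm (K :: (L.map l ++ L.map (fun k => (κ k)ᶜ))) (by simp) (by
          intro A hA
          simp only [List.mem_cons, List.mem_append, List.mem_map] at hA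
          rcases hA with rfl | ⟨k, hk, rfl⟩ | ⟨k, hk, rfl⟩
          · exact hKc
          · exact (hκl k hk).2.1.1
          · exact (hκl k hk).1.2) (by
          have hT : ∀ k ∈ L, ∃ f ∈ F, f ∈ l k := by
            intro k hk
            obtain ⟨f, hf, hfk⟩ := (hL k hk).2 True
            exact ⟨f, hf, ((hκl k hk).2.2.2.1 f hf).2 (by simpa using hfk)⟩
          have hB : ∀ k ∈ L, ∃ f ∈ F, f ∉ κ k := by
            intro k hk
            obtain ⟨f, hf, hfk⟩ := (hL k hk).2 False
            refine ⟨f, hf, fun h => ?_⟩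
            have := ((hκl k hk).2.2.1 f hf).1 h
            tauto
          have hTB : ∀ k ∈ L, ∀ k' ∈ L, (l k ∩ (κ k')ᶜ).Nonempty := by
            intro k hk k' hk'
            rcases hpair k hk k' hk' with rfl | h
            · exact (hκl k hk).2.2.2.2
            · obtain ⟨f, hf, h1, h2⟩ := h True False
              refine ⟨f, ((hκl k hk).2.2.2.1 f hf).2 (by simpa using h1), fun h => ?_⟩
              have := ((hκl k' hk').2.2.1 f hf).1 h
              tauto
          intro A hA B hB'
          simp only [List.mem_cons, List.mem_append, List.mem_map] at hA hB'
          rcases hA with rfl | ⟨k, hk, rfl⟩ | ⟨k, hk, rfl⟩ <;>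
          rcases hB' with rfl | ⟨k', hk', rfl⟩ | ⟨k', hk', rfl⟩
          · exact ⟨f0, hFK hf0, hFK hf0⟩
          · obtain ⟨f, hf, h⟩ := hT k' hk'
            exact ⟨f, hFK hf, h⟩
          · obtain ⟨f, hf, h⟩ := hB k' hk'
            exact ⟨f, hFK hf, h⟩
          · obtain ⟨f, hf, h⟩ := hT k hk
            exact ⟨f, h, hFK hf⟩
          · rcases hpair k hk k' hk' with rfl | h
            · obtain ⟨f, hf, h⟩ := hT k hk
              exact ⟨f, h, h⟩
            · obtain ⟨f, hf, h1, h2⟩ := h True True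
              exact ⟨f, ((hκl k hk).2.2.2.1 f hf).2 (by simpa using h1),
                ((hκl k' hk').2.2.2.1 f hf).2 (by simpa using h2)⟩
          · exact hTB k hk k' hk'
          · obtain ⟨f, hf, h⟩ := hB k hk
            exact ⟨f, h, hFK hf⟩
          · rw [inter_comm]; exact hTB k' hk' k hk
          · rcases hpair k hk k' hk' with rfl | h
            · obtain ⟨f, hf, h⟩ := hB k hk
              exact ⟨f, h, h⟩
            · obtain ⟨f, hf, h1, h2⟩ := h False False
              have e1 := (hκl k hk).2.2.1 f hf
              have e2 := (hκl k' hk').2.2.1 f hf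
              exact ⟨f, fun h => by tauto, fun h => by tauto⟩)
        refine ⟨p, hp K (by simp), fun k hk => ⟨hp _ ?_, hp (κ k)ᶜ ?_⟩⟩
        · simp only [List.mem_cons, List.mem_append, List.mem_map]
          exact Or.inr (Or.inl ⟨k, hk, rfl⟩)
        · simp only [List.mem_cons, List.mem_append, List.mem_map]
          exact Or.inr (Or.inr ⟨k, hk, rfl⟩)
      obtain ⟨hpK, hpL⟩ := hp
      obtain ⟨h, hh, hph, hd⟩ := hthin p
      obtain ⟨f1, hf1, hf1h⟩ : ∃ f ∈ F, f ∈ h := by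
        by_contra hc
        push Not at hc
        exact hKm hᶜ hh.2 hc hpK hph
      have : ∀ k, ∃ k' : Set X, k ∈ L → IsHalfspace k' ∧ (∀ f ∈ F, (f ∈ k' ↔ f ∈ k)) ∧
          ∀ σ : Prop, ∃ s ∈ insert p (F ∩ h), (s ∈ k' ↔ σ) := by
        intro k
        by_cases hk : k ∈ L
        · obtain ⟨h1, h2, h3, h4, -⟩ := hκl k hk
          obtain ⟨h5, h6⟩ := hpL k hk
          by_cases hex : ∃ f ∈ F, f ∈ h ∧ f ∈ k
          · obtain ⟨f, hf, hfh, hfk⟩ := hex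
            refine ⟨κ k, fun _ => ⟨h1, h3, fun σ => ?_⟩⟩
            have := (h3 f hf).2 hfk
            by_cases hσ : σ
            · exact ⟨f, Or.inr ⟨hf, hfh⟩, by tauto⟩
            · exact ⟨p, Or.inl rfl, by tauto⟩
          · have h7 : f1 ∉ k := fun h => hex ⟨f1, hf1, hf1h, h⟩
            refine ⟨l k, fun _ => ⟨h2, h4, fun σ => ?_⟩⟩
            have := (h4 f1 hf1)
            by_cases hσ : σ
            · exact ⟨p, Or.inl rfl, by tauto⟩
            · exact ⟨f1, Or.inr ⟨hf1, hf1h⟩, by tauto⟩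
        · exact ⟨∅, fun h => absurd h hk⟩
      choose k' hk' using this
      set E : Set X := insert p (F ∩ h) with hE
      have hEf : E.Finite := (hF.inter_of_left h).insert p
      have hEh : E ⊆ h := by
        rintro x (rfl | hx)
        · exact hph
        · exact hx.2
      let F' : Set X := (fun q : X × X × X => med hm q.1 q.2.1 q.2.2) '' (E ×ˢ (E ×ˢ F))
      have hF'mem : ∀ s ∈ E, ∀ t ∈ E, ∀ f ∈ F, med hm s t f ∈ F' := by
        intro s hs t ht f hf
        exact ⟨(s, t, f), ⟨hs, ht, hf⟩, rfl⟩
      have hF'h : F' ⊆ h := by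
        rintro _ ⟨⟨s, t, f⟩, ⟨hs, ht, hf⟩, rfl⟩
        simp only [maj hm hh]
        exact Or.inl ⟨hEh hs, hEh ht⟩
      have hG : Good (L.map k') F' := by
        refine ⟨(hEf.prod (hEf.prod hF)).image _,
          ⟨_, hF'mem p (Or.inl rfl) p (Or.inl rfl) f0 hf0⟩, ?_, ?_⟩
        · intro g hg
          obtain ⟨k, hk, rfl⟩ := List.mem_map.1 hg
          obtain ⟨h1, h2, h3⟩ := hk' k hk
          refine ⟨h1, fun σ => ?_⟩
          obtain ⟨s, hs, hsσ⟩ := h3 σ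
          refine ⟨_, hF'mem s hs s hs f0 hf0, ?_⟩
          rw [maj hm h1]; tauto
        · rw [List.pairwise_map]
          refine List.Pairwise.imp_of_mem ?_ hP
          intro k m hk hm' hkm σ τ
          obtain ⟨h1, h2, h3⟩ := hk' k hk
          obtain ⟨h4, h5, h6⟩ := hk' m hm'
          obtain ⟨s, hs, hsσ⟩ := h3 σ
          obtain ⟨t, ht, htτ⟩ := h6 τ
          obtain ⟨f, hf, e1, e2⟩ := hkm σ τ
          have e3 := h2 f hf
          have e4 := h5 f hf
          refine ⟨_, hF'mem s hs t ht f hf, ?_, ?_⟩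
          · rw [maj hm h1]; tauto
          · rw [maj hm h4]; tauto
      obtain ⟨L', F'', h1, -, h3⟩ := PL hm hr hG hh
        (fun x hx => ⟨subset_closure (hF'h hx), hd x⟩) isOpen_univ (subset_univ _)
      exact ⟨L', F'', h1, by rw [h3]; simp [hN]⟩
  obtain ⟨L, F, hG, hN⟩ := this (n + 1)
  have := hG.le hr
  omega

end Fourth
end MedSp
namespace MedSp

open Set Filter Topology

section Fifth
variable {X : Type*} [MetricSpace X]

lemma hs_preimage {g : X → X} (hg : Isometry g) {h : Set X} (hh : IsHalfspace h) :
    IsHalfspace (g ⁻¹' h) := by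
  have key : ∀ a b z : X, z ∈ mInterval a b → g z ∈ mInterval (g a) (g b) := by
    intro a b z hz
    rw [memI] at *
    rw [hg.dist_eq, hg.dist_eq, hg.dist_eq]; exact hz
  exact ⟨fun a ha b hb z hz => hh.1 _ ha _ hb (key _ _ _ hz),
    fun a ha b hb z hz => hh.2 _ ha _ hb (key _ _ _ hz)⟩

lemma iso_open {g : X → X} (hg : Isometry g) (hs : Function.Surjective g) : IsOpenMap g :=
  (isHomeomorph_iff_isEmbedding_surjective.2 ⟨hg.isEmbedding, hs⟩).isOpenMap

lemma exists_nonmeagre {ι : Type*} [Countable ι] {A : Set X} (hA : ¬ IsMeagre A)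
    (S : ι → Set X) (hS : A ⊆ ⋃ i, S i) : ∃ i, ¬ IsMeagre (S i) := by
  by_contra hc
  push Not at hc
  exact hA (IsMeagre.mono hS (isMeagre_iUnion hc))


lemma all_int (hm : IsMedianSpace X) [ConnectedSpace X] [ProperSpace X] {n : ℕ} (hr : RankLe X n)
    (htrans : ∀ x y : X, ∃ f : X → X, Isometry f ∧ Function.Surjective f ∧ f x = y)
    {h : Set X} (hh : IsHalfspace h) (hne : h.Nonempty) : (interior h).Nonempty := by
  by_contra hc
  rw [not_nonempty_iff_eq_empty, interior_eq_empty_iff_dense_compl] at hc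
  obtain ⟨q, hq⟩ := hne
  refine no_thin hm hr fun p => ?_
  obtain ⟨g, hg, hs, hgp⟩ := htrans p q
  refine ⟨g ⁻¹' h, hs_preimage hg hh, ?_, ?_⟩
  · rw [mem_preimage, hgp]; exact hq
  · exact hc.preimage (iso_open hg hs)

/-- Points in the closure of two of the three halfspaces. -/
def FF (T : Fin 3 → Set X) : Set X :=
  ⋃ p : {p : Fin 3 × Fin 3 // p.1 ≠ p.2}, closure (T p.1.1) ∩ closure (T p.1.2)

lemma FF_closed (T : Fin 3 → Set X) : IsClosed (FF T) :=
  isClosed_iUnion_of_finite fun _ => isClosed_closure.inter isClosed_closure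

lemma FF_meagre (hm : IsMedianSpace X) [ConnectedSpace X] [ProperSpace X] {n : ℕ} (hr : RankLe X n)
    (T : Fin 3 → Set X) (hT : ∀ i, IsHalfspace (T i))
    (hd : ∀ i j, i ≠ j → Disjoint (T i) (T j)) : IsMeagre (FF T) := by
  refine isMeagre_iUnion fun p => IsNowhereDense.isMeagre ?_
  have hc : IsClosed (closure (T p.1.1) ∩ closure (T p.1.2)) :=
    isClosed_closure.inter isClosed_closure
  rw [IsNowhereDense, hc.closure_eq, ← subset_empty_iff, ← hyper_nd hm hr (hT p.1.1)]
  refine interior_mono (inter_subset_inter_right _ (closure_mono ?_))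
  exact (hd _ _ p.2).subset_compl_left

lemma nested_contra (T S : Fin 3 → Set X) (y s : X) (b : Fin 3 → X)
    (hTd : ∀ i j, i ≠ j → Disjoint (T i) (T j)) (hSd : ∀ i j, i ≠ j → Disjoint (S i) (S j))
    (hb : ∀ i : Fin 3, (b i : X) ∈ T i ∧ b i ∈ S i)
    (hy : ∀ i, y ∈ closure (T i)) (hs : ∀ i, s ∈ closure (S i))
    (hyS : y ∉ FF S) (hsT : s ∉ FF T) : ∃ i, TransverseSets (T i) (S i) := by
  by_contra hc
  push Not at hc
  have hnest : ∀ i, T i ⊆ S i ∨ S i ⊆ T i := by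
    intro i
    by_contra hn
    push Not at hn
    obtain ⟨⟨u, hu⟩, ⟨v, hv⟩⟩ := And.imp not_subset.1 not_subset.1 hn
    obtain ⟨j, hj⟩ : ∃ j : Fin 3, i ≠ j := by
      fin_cases i
      · exact ⟨1, by decide⟩
      · exact ⟨0, by decide⟩
      · exact ⟨0, by decide⟩
    refine hc i ⟨⟨b i, hb i⟩, ⟨v, hv.2, hv.1⟩, ⟨u, hu⟩, ⟨b j, ?_, ?_⟩⟩
    · exact fun h => disjoint_left.1 (hTd i j hj) h (hb j).1
    · exact fun h => disjoint_left.1 (hSd i j hj) h (hb j).2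
  have e1 : ∀ i j, i ≠ j → T i ⊆ S i → T j ⊆ S j → False := fun i j hij h1 h2 =>
    hyS (mem_iUnion.2 ⟨⟨(i, j), hij⟩, closure_mono h1 (hy i), closure_mono h2 (hy j)⟩)
  have e2 : ∀ i j, i ≠ j → S i ⊆ T i → S j ⊆ T j → False := fun i j hij h1 h2 =>
    hsT (mem_iUnion.2 ⟨⟨(i, j), hij⟩, closure_mono h1 (hs i), closure_mono h2 (hs j)⟩)
  have a1 := e1 0 1 (by decide)
  have a2 := e1 0 2 (by decide)
  have a3 := e1 1 2 (by decide)
  have b1 := e2 0 1 (by decide)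
  have b2 := e2 0 2 (by decide)
  have b3 := e2 1 2 (by decide)
  have h0 := hnest 0
  have h1 := hnest 1
  have h2 := hnest 2
  tauto

lemma step_lemma (hm : IsMedianSpace X) [ConnectedSpace X] [ProperSpace X] {n : ℕ} (hr : RankLe X n)
    (H : X → Fin 3 → Set X) (hH : ∀ y i, IsHalfspace (H y i))
    (hd : ∀ y i j, i ≠ j → Disjoint (H y i) (H y j)) (hcl : ∀ y i, y ∈ closure (H y i))
    (b : Fin 3 → X) (A : Set X) (hA : ¬ IsMeagre A) (hb : ∀ s ∈ A, ∀ i, b i ∈ H s i) :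
    ∃ y ∈ A, ∃ i, ¬ IsMeagre {s ∈ A | TransverseSets (H y i) (H s i)} := by
  have hW : (interior (closure A)).Nonempty := by
    rw [nonempty_iff_ne_empty]
    intro h
    exact hA (IsNowhereDense.isMeagre h)
  obtain ⟨𝓑, h𝓑c, h𝓑e, h𝓑⟩ := TopologicalSpace.exists_countable_basis X
  have : Countable 𝓑 := h𝓑c.to_subtype
  obtain ⟨⟨B, hB𝓑⟩, hAB⟩ := exists_nonmeagre hA
    (fun B : 𝓑 => {s ∈ A | B.1 ⊆ interior (closure A) ∧ B.1.Nonempty ∧ Disjoint B.1 (FF (H s))}) (by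
    intro s hs
    have hopen : IsOpen (interior (closure A) \ FF (H s)) :=
      isOpen_interior.sdiff (FF_closed _)
    obtain ⟨z, hz⟩ : (interior (closure A) \ FF (H s)).Nonempty := by
      by_contra hc
      rw [not_nonempty_iff_eq_empty, sdiff_eq_empty] at hc
      exact not_isMeagre_of_isOpen isOpen_interior hW
        (IsMeagre.mono hc (FF_meagre hm hr (H s) (hH s) (hd s)))
    obtain ⟨B, hB, hzB, hBs⟩ := h𝓑.exists_subset_of_mem_open hz hopen
    refine mem_iUnion.2 ⟨⟨B, hB⟩, hs, fun x hx => (hBs hx).1, ⟨z, hzB⟩, ?_⟩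
    exact disjoint_left.2 fun x hx => (hBs hx).2)
  obtain ⟨s0, hs0, hBW, ⟨z, hz⟩, -⟩ := nonempty_of_not_isMeagre hAB
  obtain ⟨y, hyB, hyA⟩ : (B ∩ A).Nonempty :=
    mem_closure_iff.1 (interior_subset (hBW hz)) B (h𝓑.isOpen hB𝓑) hz
  refine ⟨y, hyA, ?_⟩
  by_contra hc
  push Not at hc
  apply hAB
  refine IsMeagre.mono (s := FF (H y) ∪
    ⋃ i : Fin 3, {s ∈ A | TransverseSets (H y i) (H s i)}) ?_
    ((FF_meagre hm hr (H y) (hH y) (hd y)).union (isMeagre_iUnion hc))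
  rintro s ⟨hsA, -, -, hdis⟩
  by_cases hsy : s ∈ FF (H y)
  · exact Or.inl hsy
  · right
    obtain ⟨i, hi⟩ := nested_contra (H y) (H s) y s b (hd y) (hd s)
      (fun i => ⟨hb y hyA i, hb s hsA i⟩) (hcl y) (hcl s) (disjoint_left.1 hdis hyB) hsy
    exact mem_iUnion.2 ⟨i, hsA, hi⟩

lemma final (hm : IsMedianSpace X) [ConnectedSpace X] [LocallyCompactSpace X] {n : ℕ} (hr : RankLe X n)
    (htrans : ∀ x y : X, ∃ f : X → X, Isometry f ∧ Function.Surjective f ∧ f x = y)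
    (x : X) (T : Fin 3 → Set X) (hT : ∀ i, IsHalfspace (T i)) (hx : ∀ i, x ∈ closure (T i))
    (hTd : ∀ i j, i ≠ j → Disjoint (T i) (T j)) : False := by
  have : ProperSpace X := proper_of hm htrans
  choose g hg hgs hgx using fun y => htrans y x
  let H : X → Fin 3 → Set X := fun y i => g y ⁻¹' T i
  have hH : ∀ y i, IsHalfspace (H y i) := fun y i => hs_preimage (hg y) (hT i)
  have hd : ∀ y i j, i ≠ j → Disjoint (H y i) (H y j) := fun y i j hij =>
    (hTd i j hij).preimage _
  have hcl : ∀ y i, y ∈ closure (H y i) := by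
    intro y i
    have := (iso_open (hg y) (hgs y)).preimage_closure_eq_closure_preimage
      (hg y).continuous (T i)
    rw [← this, mem_preimage, hgx]
    exact hx i
  have hint : ∀ y i, (interior (H y i)).Nonempty := fun y i =>
    all_int hm hr htrans (hH y i) (closure_nonempty_iff.1 ⟨y, hcl y i⟩)
  obtain ⟨D, hDc, hDd⟩ := TopologicalSpace.exists_countable_dense X
  have : Countable D := hDc.to_subtype
  have huniv : ¬ IsMeagre (univ : Set X) := not_isMeagre_of_isOpen isOpen_univ univ_nonempty
  obtain ⟨b, hb⟩ := exists_nonmeagre huniv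
    (fun b : Fin 3 → D => {s : X | ∀ i, (b i : X) ∈ H s i}) (by
    intro s _
    have : ∀ i, ∃ d : D, (d : X) ∈ H s i := by
      intro i
      obtain ⟨d, hd1, hd2⟩ := hDd.inter_open_nonempty _ isOpen_interior (hint s i)
      exact ⟨⟨d, hd2⟩, interior_subset hd1⟩
    choose b hb using this
    exact mem_iUnion.2 ⟨b, hb⟩)
  have main : ∀ N : ℕ, ∃ (L : Fin 3 → List (Set X)) (A : Set X), ¬ IsMeagre A ∧
      (∀ s ∈ A, ∀ i, (b i : X) ∈ H s i) ∧ (L 0).length + (L 1).length + (L 2).length = N ∧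
      (∀ i, ∀ h ∈ L i, IsHalfspace h) ∧ (∀ i, (L i).Pairwise TransverseSets) ∧
      ∀ i, ∀ h ∈ L i, ∀ s ∈ A, TransverseSets h (H s i) := by
    intro N
    induction N with
    | zero => exact ⟨fun _ => [], _, hb, fun s hs => hs, by simp, by simp, by simp, by simp⟩
    | succ N ih =>
      obtain ⟨L, A, hA, hAb, hN, h1, h2, h3⟩ := ih
      obtain ⟨y, hy, i, hi⟩ := step_lemma hm hr H hH hd hcl (fun i => b i) A hA hAb
      refine ⟨Function.update L i (H y i :: L i), _, hi, fun s hs => hAb s hs.1, ?_, ?_, ?_, ?_⟩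
      · fin_cases i <;> simp [Function.update] <;> omega
      · intro j h hh
        by_cases hj : j = i
        · subst hj
          rw [Function.update_self] at hh
          rcases List.mem_cons.1 hh with rfl | hh
          · exact hH y j
          · exact h1 j h hh
        · rw [Function.update_of_ne hj] at hh
          exact h1 j h hh
      · intro j
        by_cases hj : j = i
        · subst hj
          rw [Function.update_self, List.pairwise_cons]
          exact ⟨fun h hh => trans_symm (h3 j h hh y hy), h2 j⟩
        · rw [Function.update_of_ne hj]
          exact h2 j
      · intro j h hh s hs
        by_cases hj : j = i
        · subst hj
          rw [Function.update_self] at hh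
          rcases List.mem_cons.1 hh with rfl | hh
          · exact hs.2
          · exact h3 j h hh s hs.1
        · rw [Function.update_of_ne hj] at hh
          exact h3 j h hh s hs.1
  obtain ⟨L, A, -, -, hN, h1, h2, -⟩ := main (3 * n + 1)
  have := fun i => hr (L i) (h1 i) (h2 i)
  have := this 0
  have := ‹∀ i, (L i).length ≤ n› 1
  have := ‹∀ i, (L i).length ≤ n› 2
  omega

end Fifth
end MedSp
/-- A nonempty complete connected median space of rank `n ≥ 1` with a transitive isometry
group and a point at which three branched halfspaces are pairwise disjoint is not locally
compact. -/
theorem statement15 (X : Type*) [MetricSpace X] [Nonempty X] [CompleteSpace X]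
    [ConnectedSpace X] (hmed : IsMedianSpace X)
    (n : ℕ) (hn : 1 ≤ n) (hrank : HasMedianRank X n)
    (htrans : ∀ x y : X, ∃ f : X → X, Isometry f ∧ Function.Surjective f ∧ f x = y)
    (x : X)
    (htriple : ∃ h₁ h₂ h₃ : Set X,
      (IsHalfspace h₁ ∧ x ∈ mHyperplane h₁) ∧
      (IsHalfspace h₂ ∧ x ∈ mHyperplane h₂) ∧
      (IsHalfspace h₃ ∧ x ∈ mHyperplane h₃) ∧
      Disjoint h₁ h₂ ∧ Disjoint h₁ h₃ ∧ Disjoint h₂ h₃) :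
    ¬ LocallyCompactSpace X := by
  intro hlc
  obtain ⟨h₁, h₂, h₃, ⟨a1, b1⟩, ⟨a2, b2⟩, ⟨a3, b3⟩, d1, d2, d3⟩ := htriple
  refine MedSp.final hmed (MedSp.rankLe_of hrank) htrans x ![h₁, h₂, h₃] ?_ ?_ ?_
  · intro i
    fin_cases i
    · exact a1
    · exact a2
    · exact a3
  · intro i
    fin_cases i
    · exact b1.1
    · exact b2.1
    · exact b3.1
  · intro i j hij
    fin_cases i <;> fin_cases j
    · exact absurd rfl hij
    · exact d1
    · exact d2
    · exact d1.symm
    · exact absurd rfl hij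
    · exact d3
    · exact d2.symm
    · exact d3.symm
    · exact absurd rfl hij
end
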